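/- arXiv:2409.15853 — 2 statements merged into one kernel-verified Lean document; each statement's English description precedes it below -/
import Mathlib

section
/- Let I ⊂ S be a quadratic monomial ideal with linear resolution. Then, after a suitable relabeling of the variables, the following holds: if i < j < k and x_j x_k ∈ I, then x_i x_j ∈ I or x_i x_k ∈ I. -/
open MvPolynomial

/-- `I` has a `d`-linear (free) resolution: there is a resolution
`... → S^{r 2} → S^{r 1} → S^{r 0} → I → 0` in which the generators of `S^{r 0}` map to
homogeneous generators of `I` of degree `d` and all matrices have entries which are
homogeneous of degree `1`.  (Its existence is equivalent to all graded Betti numbers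
`β_{i,j}(I)` vanishing for `j ≠ i + d`.) -/
def HasLinearResolution {K : Type*} [Field K] {σ : Type*}
    (I : Ideal (MvPolynomial σ K)) (d : ℕ) : Prop :=
  ∃ (r : ℕ → ℕ) (g : Fin (r 0) → MvPolynomial σ K)
    (M : (i : ℕ) → Fin (r i) → Fin (r (i + 1)) → MvPolynomial σ K),
    (∀ j, (g j).IsHomogeneous d) ∧
    I = Ideal.span (Set.range g) ∧
    (∀ i j k, (M i j k).IsHomogeneous 1) ∧
    (∀ v : Fin (r 0) → MvPolynomial σ K,
      (∑ j, v j * g j) = 0 ↔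
        ∃ w : Fin (r 1) → MvPolynomial σ K, v = fun j => ∑ k, M 0 j k * w k) ∧
    (∀ (i : ℕ) (v : Fin (r (i + 1)) → MvPolynomial σ K),
      ((fun j => ∑ k, M i j k * v k) = fun _ => 0) ↔
        ∃ w : Fin (r (i + 2)) → MvPolynomial σ K, v = fun k => ∑ l, M (i + 1) k l * w l)

theorem apply_mem_of_mem_smul_top {R ι : Type*} [CommRing R] {J : Ideal R} {v : ι → R}
    (hv : v ∈ J • (⊤ : Submodule R (ι → R))) (j : ι) : v j ∈ J := by
  induction hv using Submodule.smul_induction_on' with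
  | smul r hr w _ => exact Ideal.mul_mem_right _ _ hr
  | add v _ w _ hv hw => exact Ideal.add_mem _ hv hw

section LinearMatrix

variable {σ K ι κ : Type*} [Field K] [Fintype κ] {A : ι → κ → MvPolynomial σ K}

theorem mem_idealOfVars_of_isHomogeneous_one {q : MvPolynomial σ K} (hq : q.IsHomogeneous 1) :
    q ∈ idealOfVars σ K := by
  rw [← pow_one (idealOfVars σ K), mem_pow_idealOfVars_iff]
  intro b hb
  have := hq (mem_support_iff.1 hb)
  rw [← this, Finsupp.degree_eq_weight_one]; rfl

theorem mulVec_mem_idealOfVars (hA : ∀ j k, (A j k).IsHomogeneous 1)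
    (w : κ → MvPolynomial σ K) (j : ι) : ∑ k, A j k * w k ∈ idealOfVars σ K :=
  Ideal.sum_mem _ fun k _ => Ideal.mul_mem_right _ _ (mem_idealOfVars_of_isHomogeneous_one (hA j k))

theorem mulVec_mem_smul_range (hA : ∀ j k, (A j k).IsHomogeneous 1)
    (w : κ → MvPolynomial σ K) (hw : ∀ j, ∑ k, A j k * w k ∈ idealOfVars σ K ^ 2) :
    Matrix.mulVecLin (Matrix.of A) w ∈
      idealOfVars σ K • (Matrix.mulVecLin (Matrix.of A)).range := by
  let w₀ : κ → MvPolynomial σ K := fun k => C (constantCoeff (w k))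
  have hsub : ∀ k, (w - w₀) k ∈ idealOfVars σ K := by
    intro k
    rw [← pow_one (idealOfVars σ K), mem_pow_idealOfVars_iff']
    intro b hb
    have : b = 0 := (Finsupp.degree_eq_zero_iff b).1 (Nat.lt_one_iff.1 hb)
    subst this
    simp [w₀, constantCoeff_eq]
  have h0 : Matrix.mulVecLin (Matrix.of A) w₀ = 0 := by
    ext1 j
    have hhom : (∑ k, A j k * w₀ k).IsHomogeneous 1 :=
      IsHomogeneous.sum _ _ _ fun k _ => (hA j k).mul (isHomogeneous_C _ _)
    have hmem : ∑ k, A j k * w₀ k ∈ idealOfVars σ K ^ 2 := by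
      have : ∑ k, A j k * w₀ k = ∑ k, A j k * w k - ∑ k, A j k * (w - w₀) k := by
        rw [← Finset.sum_sub_distrib]
        exact Finset.sum_congr rfl fun k _ => by simp [mul_sub]
      rw [this]
      refine Ideal.sub_mem _ (hw j) (Ideal.sum_mem _ fun k _ => ?_)
      rw [pow_two]
      exact Ideal.mul_mem_mul (mem_idealOfVars_of_isHomogeneous_one (hA j k)) (hsub k)
    change ∑ k, A j k * w₀ k = 0
    ext b
    by_contra hb
    have h1 := hhom hb
    have h2 := (mem_pow_idealOfVars_iff _ _).1 hmem b (mem_support_iff.2 hb)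
    rw [Finsupp.degree_eq_weight_one] at h2
    change 2 ≤ Finsupp.weight 1 b at h2
    omega
  have hw' : Matrix.mulVecLin (Matrix.of A) w = Matrix.mulVecLin (Matrix.of A) (w - w₀) := by
    rw [map_sub, h0, sub_zero]
  classical
  rw [hw', LinearMap.range_eq_map, ← Submodule.map_smul'']
  refine Submodule.mem_map_of_mem ?_
  rw [pi_eq_sum_univ' (w - w₀)]
  exact Submodule.sum_mem _ fun k _ => Submodule.smul_mem_smul (hsub k) trivial

end LinearMatrix

section Koszul

variable {σ : Type*} [LinearOrder σ]

/-- The sign picked up when `e_t` is moved to the front of `e_{T ∪ {t}}`. -/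
def koszulSign (t : σ) (T : Finset σ) : ℤ := (-1) ^ (T.filter (· < t)).card

theorem koszulSign_mul_self (t : σ) (T : Finset σ) : koszulSign t T * koszulSign t T = 1 := by
  rw [koszulSign, ← mul_pow]; simp

theorem koszulSign_insert {t u : σ} {T : Finset σ} (ht : t ∉ T) :
    koszulSign u (insert t T) = (if t < u then -1 else 1) * koszulSign u T := by
  unfold koszulSign
  rw [Finset.filter_insert]
  split_ifs
  · rw [Finset.card_insert_of_notMem (by simp [ht]), pow_succ]; ring
  · simp

theorem koszulSign_mul_koszulSign_insert {t u : σ} {T : Finset σ} (ht : t ∉ T) (hu : u ∉ T)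
    (htu : t ≠ u) :
    koszulSign t T * koszulSign u (insert t T) = -(koszulSign u T * koszulSign t (insert u T)) := by
  rw [koszulSign_insert ht, koszulSign_insert hu]
  rcases lt_or_gt_of_ne htu with h | h
  · simp [h, h.not_gt]; ring
  · simp [h, h.not_gt]; ring

variable [Fintype σ] {K : Type*} [Field K]

/-- The differential of the Koszul complex on the variables with coefficients in `N`, where the
chain `∑ e_T ⊗ z_T` is recorded as the function `T ↦ z_T`. -/
noncomputable def koszulD {N : Type*} [AddCommGroup N] [Module (MvPolynomial σ K) N] (z : Finset σ → N)
    (T : Finset σ) : N :=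
  ∑ t ∈ Tᶜ, koszulSign t T • (X t : MvPolynomial σ K) • z (insert t T)

variable {N N' : Type*} [AddCommGroup N] [Module (MvPolynomial σ K) N]
  [AddCommGroup N'] [Module (MvPolynomial σ K) N']

theorem koszulD_sub (z w : Finset σ → N) :
    koszulD (K := K) (z - w) = koszulD (K := K) z - koszulD (K := K) w := by
  ext T
  simp [koszulD, smul_sub, Finset.sum_sub_distrib]

theorem koszulD_add (z w : Finset σ → N) :
    koszulD (K := K) (z + w) = koszulD (K := K) z + koszulD (K := K) w := by
  ext T
  simp [koszulD, smul_add, Finset.sum_add_distrib]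

theorem koszulD_map (φ : N →ₗ[MvPolynomial σ K] N') (z : Finset σ → N) (T : Finset σ) :
    koszulD (K := K) (fun T => φ (z T)) T = φ (koszulD (K := K) z T) := by
  simp [koszulD]

theorem koszulD_koszulD (z : Finset σ → N) : koszulD (K := K) (koszulD (K := K) z) = 0 := by
  ext T
  let G : σ × σ → N := fun p => if p.1 ∉ T ∧ p.2 ∉ T ∧ p.1 ≠ p.2 then
    (koszulSign p.1 T * koszulSign p.2 (insert p.1 T)) •
      ((X p.1 * X p.2 : MvPolynomial σ K)) • z (insert p.2 (insert p.1 T)) else 0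
  have hG : koszulD (K := K) (koszulD (K := K) z) T = ∑ p : σ × σ, G p := by
    rw [Fintype.sum_prod_type]
    unfold koszulD
    rw [← Finset.sum_subset (Finset.subset_univ Tᶜ)]
    · refine Finset.sum_congr rfl fun t ht => ?_
      rw [← Finset.sum_subset (Finset.subset_univ (insert t T)ᶜ)]
      · rw [Finset.smul_sum, Finset.smul_sum]
        refine Finset.sum_congr rfl fun u hu => ?_
        simp only [Finset.mem_compl, Finset.mem_insert, not_or] at ht hu
        simp only [G]
        rw [if_pos ⟨ht, hu.2, Ne.symm hu.1⟩, mul_smul, mul_smul, smul_comm (X t) (koszulSign _ _)]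
      · intro u _ hu
        simp only [Finset.mem_compl, Finset.mem_insert, not_not] at hu
        simp only [G]
        rw [if_neg]
        rintro ⟨-, h1, h2⟩
        rcases hu with rfl | hu
        · exact h2 rfl
        · exact h1 hu
    · intro t _ ht
      simp only [Finset.mem_compl, not_not] at ht
      exact Finset.sum_eq_zero fun u _ => by simp [G, ht]
  rw [hG]
  refine Finset.sum_involution (fun p _ => p.swap) ?_ ?_ (fun _ _ => Finset.mem_univ _)
    (fun p _ => p.swap_swap)
  · rintro ⟨t, u⟩ -
    simp only [G, Prod.swap]
    by_cases h : t ∉ T ∧ u ∉ T ∧ t ≠ u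
    · rw [if_pos h, if_pos ⟨h.2.1, h.1, h.2.2.symm⟩,
        koszulSign_mul_koszulSign_insert h.1 h.2.1 h.2.2, Finset.insert_comm u t,
        mul_comm (X t : MvPolynomial σ K), neg_smul, neg_add_cancel]
    · rw [if_neg h, if_neg fun h' => h ⟨h'.2.1, h'.1, h'.2.2.symm⟩, add_zero]
  · rintro ⟨t, u⟩ - hne heq
    apply hne
    have : u = t := congrArg Prod.fst heq
    simp [G, this]

/-- A Koszul cycle is homologous to its restriction to the locus `x_v = 0`, `e_v = 0`. -/
theorem exists_koszulD_add_restrict (v : σ) {z : Finset σ → MvPolynomial σ K}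
    (hz : koszulD (K := K) z = 0) :
    ∃ u : Finset σ → MvPolynomial σ K, z = koszulD (K := K) u +
      fun T => if v ∈ T then 0 else (z T).modMonomial (Finsupp.single v 1) := by
  let u : Finset σ → MvPolynomial σ K := fun T => if v ∈ T then
    koszulSign v (T.erase v) • (z (T.erase v)).divMonomial (Finsupp.single v 1) else 0
  refine ⟨u, ?_⟩
  let y := z - koszulD (K := K) u
  have hy : koszulD (K := K) y = 0 := by
    rw [koszulD_sub, hz, koszulD_koszulD, sub_zero]
  have hyT : ∀ T, v ∉ T → y T = (z T).modMonomial (Finsupp.single v 1) := by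
    intro T hT
    have : koszulD (K := K) u T = X v * (z T).divMonomial (Finsupp.single v 1) := by
      unfold koszulD
      rw [Finset.sum_eq_single v]
      · simp only [u, Finset.mem_insert_self, if_true, Finset.erase_insert hT]
        rw [smul_comm (X v) (koszulSign _ _), ← mul_smul, koszulSign_mul_self, one_smul,
          smul_eq_mul]
      · intro t ht htv
        have : v ∉ insert t T := by simp [hT, Ne.symm htv]
        simp [u, this]
      · simp [hT]
    have h2 := divMonomial_add_modMonomial_single (z T) v
    simp only [y, Pi.sub_apply, this]
    rw [sub_eq_iff_eq_add, add_comm]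
    exact h2.symm
  have hyv : ∀ T, v ∉ T → y (insert v T) = 0 := by
    intro T hT
    have h0 : koszulD (K := K) y T = 0 := congrFun hy T
    unfold koszulD at h0
    rw [← Finset.add_sum_erase _ _ (Finset.mem_compl.2 hT)] at h0
    have h1 : X v * y (insert v T) = 0 := by
      ext b
      by_cases hb : v ∈ b.support
      · have h3 := congrArg (fun q => koszulSign v T • coeff b q) h0
        simp only [coeff_add, coeff_smul, smul_add, coeff_zero, smul_zero, coeff_sum,
          ← mul_smul, koszulSign_mul_self, one_smul, smul_eq_mul] at h3
        rw [Finset.sum_eq_zero, smul_zero, add_zero] at h3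
        · exact h3
        · intro t ht
          simp only [Finset.mem_erase, Finset.mem_compl] at ht
          have hv : v ∉ insert t T := by simp [hT, Ne.symm ht.1]
          rw [hyT _ hv, coeff_X_mul']
          split_ifs with h
          · rw [coeff_modMonomial_of_le, smul_zero]
            rw [Finsupp.single_le_iff]
            have : b v ≠ 0 := by simpa using hb
            simp [ht.1]
            omega
          · simp
      · rw [coeff_X_mul', if_neg hb, coeff_zero]
    exact (mul_eq_zero.1 h1).resolve_left (X_ne_zero v)
  have : z = koszulD (K := K) u + y := by simp [y]
  conv_lhs => rw [this]
  congr 1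
  ext1 T
  split_ifs with h
  · rw [← Finset.insert_erase h]
    exact hyv _ (by simp)
  · exact hyT T h

theorem exists_koszulD_add_of_finset (P : Finset σ) {z : Finset σ → MvPolynomial σ K}
    (hz : koszulD (K := K) z = 0) :
    ∃ u y : Finset σ → MvPolynomial σ K, z = koszulD (K := K) u + y ∧
      ∀ v ∈ P, ∀ T b, v ∈ T ∨ b v ≠ 0 → coeff b (y T) = 0 := by
  induction P using Finset.induction_on with
  | empty => exact ⟨0, z, by ext1; simp [koszulD], by simp⟩
  | insert v P _ ih =>
    obtain ⟨u, y, h, hy⟩ := ih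
    have hy0 : koszulD (K := K) y = 0 := by
      rw [h, koszulD_add, koszulD_koszulD, zero_add] at hz
      exact hz
    obtain ⟨u', h'⟩ := exists_koszulD_add_restrict v hy0
    refine ⟨u + u', fun T => if v ∈ T then 0 else (y T).modMonomial (Finsupp.single v 1), ?_, ?_⟩
    · rw [koszulD_add, add_assoc, ← h', ← h]
    · intro w hw T b hb
      dsimp only
      split_ifs with hT
      · simp
      · by_cases hbv : Finsupp.single v 1 ≤ b
        · exact coeff_modMonomial_of_le _ hbv
        · rw [coeff_modMonomial_of_not_le _ hbv]
          rcases Finset.mem_insert.1 hw with rfl | hw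
          · rw [Finsupp.single_le_iff] at hbv
            rcases hb with hb | hb
            · exact absurd hb hT
            · omega
          · exact hy w hw T b hb

/-- The Koszul complex of the variables is a resolution of the residue field. -/
theorem exists_eq_koszulD {z : Finset σ → MvPolynomial σ K} (hz : koszulD (K := K) z = 0)
    (h0 : constantCoeff (z ∅) = 0) : ∃ u : Finset σ → MvPolynomial σ K, z = koszulD (K := K) u := by
  obtain ⟨u, y, h, hy⟩ := exists_koszulD_add_of_finset Finset.univ hz
  refine ⟨u, ?_⟩
  suffices y = 0 by rw [h, this, add_zero]
  ext T b
  simp only [Pi.zero_apply, coeff_zero]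
  by_cases hb : b = 0
  · subst hb
    rcases T.eq_empty_or_nonempty with rfl | ⟨v, hv⟩
    · have : constantCoeff (koszulD (K := K) u ∅) = 0 := by
        simp [koszulD]
      rw [h, Pi.add_apply, map_add, this, zero_add] at h0
      exact h0
    · exact hy v (Finset.mem_univ _) _ _ (Or.inl hv)
  · obtain ⟨v, hv⟩ := Finsupp.ne_iff.1 hb
    exact hy v (Finset.mem_univ _) _ _ (Or.inr hv)


/-- The Koszul homology of `Z` in homological degrees below `p` is represented by no cycle with
coefficients in `𝔪 Z`. -/
def KoszulAcyclicBelow (Z : Submodule (MvPolynomial σ K) N) (p : ℕ) : Prop :=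
  ∀ z : Finset σ → N, (∀ T, z T ∈ idealOfVars σ K • Z) → koszulD (K := K) z = 0 →
    (∀ T, p ≤ T.card → z T = 0) → ∃ w : Finset σ → N, (∀ T, w T ∈ Z) ∧ koszulD (K := K) w = z

theorem KoszulAcyclicBelow.zero (Z : Submodule (MvPolynomial σ K) N) : KoszulAcyclicBelow Z 0 := by
  intro z _ _ hp
  have : z = 0 := funext fun T => hp T (Nat.zero_le _)
  exact ⟨0, fun _ => Z.zero_mem, by rw [this]; ext T; simp [koszulD]⟩

/-- Dimension shifting along the short exact sequence `0 → ker φ → Sʳ → range φ → 0`. -/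
theorem KoszulAcyclicBelow.succ {ι : Type*}
    (φ : (ι → MvPolynomial σ K) →ₗ[MvPolynomial σ K] N) {p : ℕ}
    (hm : ∀ v, φ v = 0 → ∀ j, v j ∈ idealOfVars σ K)
    (hm2 : ∀ v, φ v = 0 → (∀ j, v j ∈ idealOfVars σ K ^ 2) → v ∈ idealOfVars σ K • φ.ker)
    (h : KoszulAcyclicBelow φ.ker p) : KoszulAcyclicBelow φ.range (p + 1) := by
  intro z hzm hz hp
  have hlift : ∀ T, ∃ v : ι → MvPolynomial σ K, φ v = z T ∧ (∀ j, v j ∈ idealOfVars σ K) ∧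
      (p + 1 ≤ T.card → v = 0) := by
    intro T
    by_cases hT : p + 1 ≤ T.card
    · exact ⟨0, by simp [hp T hT], by simp, fun _ => rfl⟩
    · have := hzm T
      rw [LinearMap.range_eq_map, ← Submodule.map_smul''] at this
      obtain ⟨v, hv, hvz⟩ := this
      exact ⟨v, hvz, apply_mem_of_mem_smul_top hv, fun h => absurd h hT⟩
  choose y hyz hym hyp using hlift
  have hDy : ∀ T, φ (koszulD (K := K) y T) = 0 := by
    intro T
    rw [← koszulD_map]
    simp only [hyz]
    exact congrFun hz T
  obtain ⟨w, hw, hwD⟩ := h (koszulD (K := K) y) (fun T => hm2 _ (hDy T) fun j => by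
      simp only [koszulD, Finset.sum_apply, Pi.smul_apply]
      refine Ideal.sum_mem _ fun t _ => zsmul_mem ?_ _
      rw [pow_two, smul_eq_mul]
      exact Ideal.mul_mem_mul (Ideal.subset_span ⟨t, rfl⟩) (hym _ _))
    (koszulD_koszulD y) (fun T hT => by
      refine Finset.sum_eq_zero fun t ht => ?_
      rw [hyp _ (by rw [Finset.card_insert_of_notMem (Finset.mem_compl.1 ht)]; omega)]
      simp)
  have hu : ∀ j, ∃ u : Finset σ → MvPolynomial σ K,
      (fun T => (y - w) T j) = koszulD (K := K) u := by
    intro j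
    refine exists_eq_koszulD ?_ ?_
    · ext1 T
      have h1 := koszulD_map (K := K)
        (LinearMap.proj (R := MvPolynomial σ K) (φ := fun _ : ι => MvPolynomial σ K) j) (y - w) T
      rw [koszulD_sub, hwD, sub_self] at h1
      simpa using h1
    · have h1 : (y - w) ∅ j ∈ idealOfVars σ K ^ 1 := by
        rw [pow_one]
        exact Ideal.sub_mem _ (hym _ _) (hm _ (hw ∅) _)
      rw [mem_pow_idealOfVars_iff'] at h1
      exact h1 0 (by simp)
  choose u hu using hu
  refine ⟨fun T => φ fun j => u j T, fun T => ⟨_, rfl⟩, ?_⟩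
  ext1 T
  rw [koszulD_map]
  have h2 : koszulD (K := K) (fun T j => u j T) T = (y - w) T := by
    ext1 j
    rw [congrFun (hu j) T]
    simp [koszulD, mul_left_comm]
  rw [h2, Pi.sub_apply, map_sub, hyz, hw T, sub_zero]

theorem HasLinearResolution.koszulAcyclicBelow {I : Ideal (MvPolynomial σ K)} {d : ℕ}
    (h : HasLinearResolution I d) (p : ℕ) : KoszulAcyclicBelow I p := by
  obtain ⟨r, g, M, -, rfl, hM, h0, hs⟩ := h
  let φ (i : ℕ) := Matrix.mulVecLin (Matrix.of (M i))
  have hφ (i : ℕ) (w) : φ i w = fun j => ∑ k, M i j k * w k := rfl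
  have hker (i : ℕ) : (φ i).ker = (φ (i + 1)).range := by
    ext v
    rw [LinearMap.mem_ker, LinearMap.mem_range]
    exact (hs i v).trans ⟨fun ⟨w, hw⟩ => ⟨w, hw.symm⟩, fun ⟨w, hw⟩ => ⟨w, hw.symm⟩⟩
  have key (p : ℕ) : ∀ i, KoszulAcyclicBelow (φ i).range p := by
    induction p with
    | zero => exact fun i => KoszulAcyclicBelow.zero _
    | succ p ih =>
      intro i
      refine KoszulAcyclicBelow.succ _ ?_ ?_ ?_
      · intro v hv
        obtain ⟨w, rfl⟩ := (hs i v).1 hv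
        exact mulVec_mem_idealOfVars (hM _) w
      · intro v hv hv2
        obtain ⟨w, rfl⟩ := (hs i v).1 hv
        rw [hker]
        exact mulVec_mem_smul_range (hM _) w hv2
      · rw [hker]; exact ih _
  cases p with
  | zero => exact KoszulAcyclicBelow.zero _
  | succ p =>
    have hker0 : (Fintype.linearCombination (MvPolynomial σ K) g).ker = (φ 0).range := by
      ext v
      rw [LinearMap.mem_ker, LinearMap.mem_range]
      exact (h0 v).trans ⟨fun ⟨w, hw⟩ => ⟨w, hw.symm⟩, fun ⟨w, hw⟩ => ⟨w, hw.symm⟩⟩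
    have hrange : (Fintype.linearCombination (MvPolynomial σ K) g).range =
        Ideal.span (Set.range g) := Fintype.range_linearCombination _ _
    rw [← hrange]
    refine KoszulAcyclicBelow.succ _ ?_ ?_ ?_
    · intro v hv
      obtain ⟨w, rfl⟩ := (h0 v).1 hv
      exact mulVec_mem_idealOfVars (hM _) w
    · intro v hv hv2
      obtain ⟨w, rfl⟩ := (h0 v).1 hv
      rw [hker0]
      exact mulVec_mem_smul_range (hM _) w hv2
    · rw [hker0]; exact key _ _

end Koszul

section Obstruction

variable {σ K : Type*} [LinearOrder σ] [Fintype σ] [Field K]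

theorem coeff_koszulD_single_add_single (u : Finset σ → MvPolynomial σ K) {T : Finset σ} {a b : σ}
    (ha : a ∉ T) (hb : b ∉ T) (hab : a ≠ b) :
    coeff (Finsupp.single a 1 + Finsupp.single b 1) (koszulD (K := K) u T) =
      koszulSign a T • coeff (Finsupp.single b 1) (u (insert a T)) +
      koszulSign b T • coeff (Finsupp.single a 1) (u (insert b T)) := by
  simp only [koszulD, coeff_sum, coeff_smul, smul_eq_mul]
  rw [Finset.sum_eq_add a b hab]
  · rw [coeff_X_mul, add_comm (Finsupp.single a 1), coeff_X_mul]
  · intro c _ hc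
    rw [coeff_X_mul', if_neg, smul_zero]
    simp [hc.1.symm, hc.2.symm]
  · simp [ha]
  · simp [hb]

/-- Up to signs, the Koszul differential `e_{W \ a} ↦ e_{W \ {a, b}}` in the squarefree
multidegree `W` is the simplicial coboundary from vertices to edges. -/
theorem exists_coeff_koszulD_eq (u : Finset σ → MvPolynomial σ K) (W : Finset σ) :
    ∃ h : σ → K, ∀ a ∈ W, ∀ b ∈ W, a ≠ b → ∃ ε : ℤ,
      coeff (Finsupp.single a 1 + Finsupp.single b 1)
        (koszulD (K := K) u ((W.erase a).erase b)) = ε • (h b - h a) ∧ ε * ε = 1 := by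
  refine ⟨fun b => koszulSign b (W.erase b) • coeff (Finsupp.single b 1) (u (W.erase b)), ?_⟩
  intro a ha b hb hab
  have hbT : insert b ((W.erase a).erase b) = W.erase a :=
    Finset.insert_erase (Finset.mem_erase.2 ⟨hab.symm, hb⟩)
  have haT : insert a ((W.erase a).erase b) = W.erase b := by
    rw [Finset.erase_right_comm]
    exact Finset.insert_erase (Finset.mem_erase.2 ⟨hab, ha⟩)
  have ha' : a ∉ (W.erase a).erase b := by simp
  have hb' : b ∉ (W.erase a).erase b := by simp
  have hsign := koszulSign_mul_koszulSign_insert ha' hb' hab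
  rw [haT, hbT] at hsign
  rw [coeff_koszulD_single_add_single u ha' hb' hab, haT, hbT]
  generalize (W.erase a).erase b = T at *
  have sa := koszulSign_mul_self a T
  have sb := koszulSign_mul_self b T
  have sa' := koszulSign_mul_self a (W.erase a)
  have sb' := koszulSign_mul_self b (W.erase b)
  refine ⟨koszulSign a T * koszulSign b (W.erase b), ?_, ?_⟩
  · rw [smul_sub]
    nth_rewrite 2 [hsign]
    rw [neg_smul, sub_neg_eq_add, smul_smul, smul_smul, mul_assoc, mul_assoc, sa', sb', mul_one,
      mul_one]
  · rw [mul_mul_mul_comm, sa, sb', mul_one]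

/-- If the Koszul homology of a monomial ideal is concentrated on its linear strand, then a vertex
`v` and a connected set `C` of vertices without edge to `v`, in the graph of pairs with
`x_a x_b ∉ I`, have no two nonadjacent common neighbours. -/
theorem false_of_nonadjacent_common_neighbors {A : Set (σ →₀ ℕ)} {I : Ideal (MvPolynomial σ K)}
    (hA : I = Ideal.span ((fun a => monomial a (1 : K)) '' A))
    (hI : ∀ p, KoszulAcyclicBelow I p) {v s t c₀ : σ} {C : Finset σ}
    (hvC : ∀ c ∈ C, (X v * X c : MvPolynomial σ K) ∈ I) (hv : v ∉ C) (hs : s ∉ C) (ht : t ∉ C)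
    (hst : s ≠ t) (hsv : s ≠ v) (htv : t ≠ v)
    (hstI : (X s * X t : MvPolynomial σ K) ∈ I) (hsvI : (X s * X v : MvPolynomial σ K) ∉ I)
    (htvI : (X t * X v : MvPolynomial σ K) ∉ I)
    (hsC : ∃ c ∈ C, (X s * X c : MvPolynomial σ K) ∉ I)
    (htC : ∃ c ∈ C, (X t * X c : MvPolynomial σ K) ∉ I)
    (hC : ∀ c ∈ C, Relation.ReflTransGen
      (fun a b => a ∈ C ∧ b ∈ C ∧ a ≠ b ∧ (X a * X b : MvPolynomial σ K) ∉ I) c₀ c) : False := by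
  have hXX : ∀ a b : σ, (X a * X b : MvPolynomial σ K) =
      monomial (Finsupp.single a 1 + Finsupp.single b 1) 1 := fun a b => by
    rw [X, X, monomial_mul, mul_one]
  have hcoeff : ∀ q ∈ I, ∀ a b : σ, (X a * X b : MvPolynomial σ K) ∉ I →
      ∀ e ≤ Finsupp.single a 1 + Finsupp.single b 1, coeff e q = 0 := by
    intro q hq a b hab e he
    by_contra hne
    rw [hA, mem_ideal_span_monomial_image] at hq
    obtain ⟨m, hm, hme⟩ := hq e (mem_support_iff.2 hne)
    apply hab
    rw [hXX, hA, mem_ideal_span_monomial_image]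
    intro x hx
    obtain rfl := Finset.mem_singleton.1 (support_monomial_subset hx)
    exact ⟨m, hm, hme.trans he⟩
  let z : Finset σ → MvPolynomial σ K := Pi.single (insert t C) (X s * X v)
  have hz : ∀ T, T ≠ insert t C → z T = 0 := fun T hT => by simp [z, hT]
  obtain ⟨w, hw, hwz⟩ := hI (Fintype.card σ + 1) (koszulD (K := K) z) (fun T => by
      refine Submodule.sum_mem _ fun u hu => zsmul_mem ?_ _
      by_cases hT : insert u T = insert t C
      · have hzT : z (insert u T) = X s * X v := by simp [z, hT]
        have hmem : ∀ x : σ, (X x : MvPolynomial σ K) ∈ idealOfVars σ K :=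
          fun x => Ideal.subset_span ⟨x, rfl⟩
        rw [hzT]
        have hu' : u ∈ insert t C := hT ▸ Finset.mem_insert_self u T
        rcases Finset.mem_insert.1 hu' with rfl | huC
        · have := Submodule.smul_mem_smul (hmem v) hstI
          convert this using 1
          simp only [smul_eq_mul]; ring
        · have := Submodule.smul_mem_smul (hmem s) (hvC u huC)
          convert this using 1
          simp only [smul_eq_mul]; ring
      · rw [hz _ hT, smul_zero]; exact Submodule.zero_mem _)
    (koszulD_koszulD z) (fun T hT => absurd (Finset.card_le_univ T) (by omega))
  obtain ⟨u, hu⟩ := exists_eq_koszulD (z := z - w) (by rw [koszulD_sub, hwz, sub_self]) (by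
    rw [Pi.sub_apply, hz ∅ (Finset.insert_ne_empty t C).symm, zero_sub, map_neg, neg_eq_zero]
    exact hcoeff _ (hw ∅) s v hsvI 0 zero_le)
  let W := insert v (insert s (insert t C))
  obtain ⟨h, hh⟩ := exists_coeff_koszulD_eq u W
  have hedge : ∀ a ∈ W, ∀ b ∈ W, a ≠ b → (X a * X b : MvPolynomial σ K) ∉ I →
      b ∈ insert t C ∨ a ∈ insert t C → h a = h b := by
    intro a ha b hb hab habI hor
    obtain ⟨ε, h1, h2⟩ := hh a ha b hb hab
    rw [← hu, Pi.sub_apply, coeff_sub, hcoeff _ (hw _) a b habI _ le_rfl, hz, coeff_zero,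
      sub_zero] at h1
    · have h3 := congrArg (fun x => ε • x) h1
      simp only [smul_smul, h2, one_smul, smul_zero] at h3
      exact (sub_eq_zero.1 h3.symm).symm
    · intro hT
      rw [← hT] at hor
      simp at hor
  have hsvne : h s ≠ h v := by
    intro heq
    obtain ⟨ε, h1, -⟩ := hh s (by simp [W]) v (by simp [W]) hsv
    have hT : (W.erase s).erase v = insert t C := by
      rw [Finset.erase_right_comm, Finset.erase_insert (by simp [hv, hsv.symm, htv.symm]),
        Finset.erase_insert (by simp [hs, hst])]
    rw [← hu, Pi.sub_apply, coeff_sub, hcoeff _ (hw _) s v hsvI _ le_rfl, hT, heq, sub_self,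
      smul_zero, sub_zero] at h1
    simp [z, hXX] at h1
  have hCW : ∀ c ∈ C, c ∈ W := fun c hc => by simp [W, hc]
  have hCT : ∀ c ∈ C, c ∈ insert t C := fun c hc => Finset.mem_insert_of_mem hc
  have hconst : ∀ c ∈ C, h c = h c₀ := by
    intro c hc
    induction hC c hc with
    | refl => rfl
    | tail _ hbc ih =>
      obtain ⟨hb, hc, hne, hI⟩ := hbc
      rw [← ih hb, hedge _ (hCW _ hb) _ (hCW _ hc) hne hI (Or.inl (hCT _ hc))]
  obtain ⟨c, hc, hsc⟩ := hsC
  obtain ⟨c', hc', htc⟩ := htC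
  apply hsvne
  rw [hedge s (by simp [W]) c (hCW _ hc) (fun h => hs (h ▸ hc)) hsc (Or.inl (hCT _ hc)),
    hconst c hc, ← hconst c' hc',
    ← hedge t (by simp [W]) c' (hCW _ hc') (fun h => ht (h ▸ hc')) htc (Or.inl (hCT _ hc')),
    hedge t (by simp [W]) v (by simp [W]) htv htvI (Or.inr (Finset.mem_insert_self _ _))]

end Obstruction

section PerfectElimination

variable {α : Type*} (G : SimpleGraph α)

/-- Any two nonadjacent vertices `s`, `t` adjacent to `v` are not both adjacent to a connected set
of vertices avoiding `v` and its neighbours. -/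
def NeighborSeparatorsAreCliques : Prop :=
  ∀ (v s t c₀ : α) (C : Finset α), v ∉ C → (∀ c ∈ C, ¬ G.Adj v c) → G.Adj s v → G.Adj t v →
    s ≠ t → (∃ c ∈ C, G.Adj s c) → (∃ c ∈ C, G.Adj t c) →
    (∀ c ∈ C, Relation.ReflTransGen (fun a b => a ∈ C ∧ b ∈ C ∧ G.Adj a b) c₀ c) → G.Adj s t

/-- The neighbours of `u` in `V` form a clique. -/
def IsSimplicialIn (V : Finset α) (u : α) : Prop :=
  ∀ a ∈ V, ∀ b ∈ V, G.Adj u a → G.Adj u b → a ≠ b → G.Adj a b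

variable {G}

theorem NeighborSeparatorsAreCliques.exists_isSimplicialIn_not_adj
    (hG : NeighborSeparatorsAreCliques G) (V : Finset α) :
    ∀ v ∈ V, (∃ x ∈ V, x ≠ v ∧ ¬ G.Adj v x) →
      ∃ u ∈ V, u ≠ v ∧ ¬ G.Adj v u ∧ IsSimplicialIn G V u := by
  classical
  induction V using Finset.strongInduction with
  | H V ih =>
    rintro v hv ⟨c₀, hc₀, hc₀v, hvc₀⟩
    let P : α → Prop := fun a => a ∈ V ∧ a ≠ v ∧ ¬ G.Adj v a
    let C := V.filter fun c => Relation.ReflTransGen (fun a b => P a ∧ P b ∧ G.Adj a b) c₀ c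
    let S := V.filter fun s => s ∉ C ∧ ∃ c ∈ C, G.Adj s c
    have hc₀C : c₀ ∈ C := Finset.mem_filter.2 ⟨hc₀, .refl⟩
    have hCP : ∀ c ∈ C, P c := by
      intro c hc
      rcases (Finset.mem_filter.1 hc).2.cases_tail with rfl | ⟨b, -, -, h, -⟩
      · exact ⟨hc₀, hc₀v, hvc₀⟩
      · exact h
    have hCext : ∀ c ∈ C, ∀ x ∈ V, G.Adj c x → P x → x ∈ C := fun c hc x hx hcx hPx =>
      Finset.mem_filter.2 ⟨hx, (Finset.mem_filter.1 hc).2.tail ⟨hCP c hc, hPx, hcx⟩⟩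
    have hCconn : ∀ c ∈ C,
        Relation.ReflTransGen (fun a b => a ∈ C ∧ b ∈ C ∧ G.Adj a b) c₀ c := by
      intro c hc
      have hr := (Finset.mem_filter.1 hc).2
      clear hc
      induction hr with
      | refl => exact .refl
      | @tail b c hb hbc ih' =>
        have hbC : b ∈ C := Finset.mem_filter.2 ⟨hbc.1.1, hb⟩
        exact ih'.tail ⟨hbC, hCext b hbC c hbc.2.1.1 hbc.2.2 hbc.2.1, hbc.2.2⟩
    have hSv : ∀ s ∈ S, G.Adj s v := by
      intro s hs
      obtain ⟨hsV, hsC, c, hc, hsc⟩ := Finset.mem_filter.1 hs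
      by_contra hsv
      refine hsC (hCext c hc s hsV hsc.symm ⟨hsV, ?_, fun h => hsv h.symm⟩)
      rintro rfl
      exact (hCP c hc).2.2 hsc
    have hSclique : ∀ s ∈ S, ∀ t ∈ S, s ≠ t → G.Adj s t := fun s hs t ht hst =>
      hG v s t c₀ C (fun h => (hCP v h).2.1 rfl) (fun c hc => (hCP c hc).2.2) (hSv s hs) (hSv t ht)
        hst (Finset.mem_filter.1 hs).2.2 (Finset.mem_filter.1 ht).2.2 hCconn
    have hsub : C ∪ S ⊂ V := by
      refine Finset.ssubset_iff_subset_ne.2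
        ⟨Finset.union_subset (Finset.filter_subset _ _) (Finset.filter_subset _ _), fun h => ?_⟩
      rw [← h] at hv
      rcases Finset.mem_union.1 hv with h | h
      · exact (hCP v h).2.1 rfl
      · exact (hSv v h).ne rfl
    suffices ∃ u ∈ C, IsSimplicialIn G (C ∪ S) u by
      obtain ⟨u, huC, hu⟩ := this
      have hmem : ∀ a ∈ V, G.Adj u a → a ∈ C ∪ S := by
        intro a ha hua
        by_cases haC : a ∈ C
        · exact Finset.mem_union_left _ haC
        · exact Finset.mem_union_right _ (Finset.mem_filter.2 ⟨ha, haC, u, huC, hua.symm⟩)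
      exact ⟨u, (hCP u huC).1, (hCP u huC).2.1, (hCP u huC).2.2,
        fun a ha b hb hua hub hab => hu a (hmem a ha hua) b (hmem b hb hub) hua hub hab⟩
    by_cases hS : ∃ s ∈ S, ∃ x ∈ C ∪ S, x ≠ s ∧ ¬ G.Adj s x
    · obtain ⟨s, hs, hx⟩ := hS
      obtain ⟨u, hu, hus, hsu, hsimp⟩ := ih _ hsub s (Finset.mem_union_right _ hs) hx
      rcases Finset.mem_union.1 hu with h | h
      · exact ⟨u, h, hsimp⟩
      · exact absurd (hSclique s hs u h hus.symm) hsu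
    · push Not at hS
      by_cases hCx : ∃ c ∈ C, ∃ x ∈ C ∪ S, x ≠ c ∧ ¬ G.Adj c x
      · obtain ⟨c, hc, hx⟩ := hCx
        obtain ⟨u, hu, huc, hcu, hsimp⟩ := ih _ hsub c (Finset.mem_union_left _ hc) hx
        rcases Finset.mem_union.1 hu with h | h
        · exact ⟨u, h, hsimp⟩
        · exact absurd (hS u h c (Finset.mem_union_left _ hc) huc.symm).symm hcu
      · push Not at hCx
        refine ⟨c₀, hc₀C, fun a ha b hb _ _ hab => ?_⟩
        rcases Finset.mem_union.1 ha with h | h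
        · exact hCx a h b hb hab.symm
        · exact hS a h b hb hab.symm

theorem NeighborSeparatorsAreCliques.exists_isSimplicialIn
    (hG : NeighborSeparatorsAreCliques G) {V : Finset α} (hV : V.Nonempty) :
    ∃ u ∈ V, IsSimplicialIn G V u := by
  by_cases h : ∃ v ∈ V, ∃ x ∈ V, x ≠ v ∧ ¬ G.Adj v x
  · obtain ⟨v, hv, hx⟩ := h
    obtain ⟨u, hu, -, -, hsimp⟩ := hG.exists_isSimplicialIn_not_adj V v hv hx
    exact ⟨u, hu, hsimp⟩
  · push Not at h
    obtain ⟨u, hu⟩ := hV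
    exact ⟨u, hu, fun a ha b hb _ _ hab => h a ha b hb hab.symm⟩

theorem NeighborSeparatorsAreCliques.exists_perfectElimination_list
    (hG : NeighborSeparatorsAreCliques G) (V : Finset α) :
    ∃ l : List α, l.Nodup ∧ (∀ x, x ∈ l ↔ x ∈ V) ∧
      ∀ (i j k : ℕ) (hij : i < j) (hjk : j < k) (hk : k < l.length),
        G.Adj l[i] l[j] → G.Adj l[i] l[k] → G.Adj l[j] l[k] := by
  classical
  induction V using Finset.strongInduction with
  | H V ih =>
    rcases V.eq_empty_or_nonempty with rfl | hV
    · exact ⟨[], by simp, by simp, fun i j k _ _ hk => by simp at hk⟩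
    obtain ⟨u, hu, hsimp⟩ := hG.exists_isSimplicialIn hV
    obtain ⟨l, hnd, hl, hord⟩ := ih _ (Finset.erase_ssubset hu)
    refine ⟨u :: l, List.nodup_cons.2 ⟨by simp [hl], hnd⟩, fun x => ?_, ?_⟩
    · rw [List.mem_cons, hl, Finset.mem_erase]
      by_cases hx : x = u
      · simp [hx, hu]
      · simp [hx]
    · intro i j k hij hjk hk
      obtain ⟨j, rfl⟩ : ∃ j', j = j' + 1 := ⟨j - 1, by omega⟩
      obtain ⟨k, rfl⟩ : ∃ k', k = k' + 1 := ⟨k - 1, by omega⟩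
      rw [List.length_cons] at hk
      have hV' : ∀ m (hm : m < l.length), l[m] ∈ V := fun m hm =>
        Finset.mem_of_mem_erase ((hl _).1 (List.getElem_mem hm))
      cases i with
      | zero =>
        simp only [List.getElem_cons_zero, List.getElem_cons_succ]
        intro h1 h2
        refine hsimp _ (hV' _ _) _ (hV' _ _) h1 h2 fun h => ?_
        have := (hnd.getElem_inj_iff).1 h
        omega
      | succ i =>
        simp only [List.getElem_cons_succ]
        exact hord i j k (by omega) (by omega) (by omega)

theorem NeighborSeparatorsAreCliques.exists_perm {n : ℕ} {G : SimpleGraph (Fin n)}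
    (hG : NeighborSeparatorsAreCliques G) :
    ∃ π : Equiv.Perm (Fin n), ∀ i j k : Fin n, i < j → j < k →
      G.Adj (π i) (π j) → G.Adj (π i) (π k) → G.Adj (π j) (π k) := by
  obtain ⟨l, hnd, hl, hord⟩ := hG.exists_perfectElimination_list Finset.univ
  let e := hnd.getEquivOfForallMemList l fun x => (hl x).2 (Finset.mem_univ x)
  have hlen : n = l.length := by simpa using (Fintype.card_congr e).symm
  exact ⟨(finCongr hlen).trans e, fun i j k hij hjk =>
    hord i j k hij hjk (hlen ▸ k.isLt)⟩

end PerfectElimination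

/-- **Property (*).** Let `I` be a quadratic monomial ideal with linear resolution.
After a suitable relabelling `σ` of the variables: if `i < j < k` and `x_j x_k ∈ I`,
then `x_i x_j ∈ I` or `x_i x_k ∈ I`. -/
theorem property_star {K : Type*} [Field K] {n : ℕ}
    (I : Ideal (MvPolynomial (Fin n) K))
    (hquad : ∃ A : Set (Fin n →₀ ℕ), (∀ a ∈ A, a.sum (fun _ e => e) = 2) ∧
      I = Ideal.span ((fun a => (monomial a (1 : K) : MvPolynomial (Fin n) K)) '' A))
    (hlin : HasLinearResolution I 2) :
    ∃ σ : Equiv.Perm (Fin n), ∀ i j k : Fin n, i < j → j < k →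
      X (σ j) * X (σ k) ∈ I → X (σ i) * X (σ j) ∈ I ∨ X (σ i) * X (σ k) ∈ I := by
  obtain ⟨A, -, hA⟩ := hquad
  let G : SimpleGraph (Fin n) :=
    { Adj := fun a b => a ≠ b ∧ (X a * X b : MvPolynomial (Fin n) K) ∉ I
      symm := ⟨fun a b h => ⟨h.1.symm, mul_comm (X a : MvPolynomial (Fin n) K) (X b) ▸ h.2⟩⟩
      loopless := ⟨fun a h => h.1 rfl⟩ }
  have hG : NeighborSeparatorsAreCliques G := by
    intro v s t c₀ C hv hvC hsv htv hst hsC htC hC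
    refine ⟨hst, fun hstI => ?_⟩
    refine false_of_nonadjacent_common_neighbors hA hlin.koszulAcyclicBelow (v := v) (c₀ := c₀)
      (fun c hc => ?_) hv (fun h => hvC s h hsv.symm) (fun h => hvC t h htv.symm)
      hst hsv.1 htv.1 hstI hsv.2 htv.2 (hsC.imp fun c h => ⟨h.1, h.2.2⟩)
      (htC.imp fun c h => ⟨h.1, h.2.2⟩) hC
    by_contra h
    exact hvC c hc ⟨fun h' => hv (h' ▸ hc), h⟩
  obtain ⟨π, hπ⟩ := hG.exists_perm
  refine ⟨π, fun i j k hij hjk hI => ?_⟩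
  by_contra h
  push Not at h
  exact (hπ i j k hij hjk ⟨fun h' => hij.ne (π.injective h'), h.1⟩
    ⟨fun h' => (hij.trans hjk).ne (π.injective h'), h.2⟩).2 hI
end

section
/- Let I ⊂ S be a monomial ideal. Then I has a linear resolution if and only if its polarization I^℘ has a linear resolution. -/
open MvPolynomial

/-- The polarization of an exponent vector: the squarefree exponent vector of
`u^℘ = ∏_i ∏_{j<a_i} x_{i,j}`. -/
noncomputable def polarize {n : ℕ} (a : Fin n →₀ ℕ) : (Fin n × ℕ) →₀ ℕ :=
  a.sum fun i e => (Finset.range e).sum fun j => Finsupp.single (i, j) 1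


namespace LinearResolution

open Matrix

section Homogeneous

variable {K : Type*} [Field K] {σ : Type*}

theorem homogeneousComponent_mul_of_le {p : MvPolynomial σ K} {e D : ℕ} (hp : p.IsHomogeneous e)
    (hD : e ≤ D) (q : MvPolynomial σ K) :
    homogeneousComponent D (p * q) = p * homogeneousComponent (D - e) q := by
  classical
  conv_lhs => rw [← sum_homogeneousComponent q, Finset.mul_sum, map_sum]
  have hterm (i : ℕ) : homogeneousComponent D (p * homogeneousComponent i q) =
      if i = D - e then p * homogeneousComponent i q else 0 := by
    rw [homogeneousComponent_of_mem (n := e + i) (hp.mul (homogeneousComponent_isHomogeneous i q))]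
    exact if_congr (by omega) rfl rfl
  simp_rw [hterm, Finset.sum_ite_eq', Finset.mem_range]
  split_ifs with h
  · rfl
  · rw [homogeneousComponent_eq_zero _ _ (by omega), mul_zero]

theorem homogeneousComponent_mul_of_lt {p : MvPolynomial σ K} {e D : ℕ} (hp : p.IsHomogeneous e)
    (hD : D < e) (q : MvPolynomial σ K) : homogeneousComponent D (p * q) = 0 := by
  conv_lhs => rw [← sum_homogeneousComponent q, Finset.mul_sum, map_sum]
  refine Finset.sum_eq_zero fun i _ => ?_
  rw [homogeneousComponent_of_mem (n := e + i) (hp.mul (homogeneousComponent_isHomogeneous i q)),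
    if_neg (by omega)]

/-- The vector of homogeneous components of degree `D`. -/
noncomputable def vecComponent {β : Type*} (D : ℕ) (v : β → MvPolynomial σ K) :
    β → MvPolynomial σ K :=
  fun j => homogeneousComponent D (v j)

/-- A submodule of a free module is graded if it contains the homogeneous components of each of
its elements. -/
def IsGraded {β : Type*} (N : Submodule (MvPolynomial σ K) (β → MvPolynomial σ K)) : Prop :=
  ∀ v ∈ N, ∀ D, vecComponent D v ∈ N

/-- All entries of the matrix are homogeneous of degree `e`. -/
def HomogeneousEntries {α β : Type*} (A : Matrix α β (MvPolynomial σ K)) (e : ℕ) : Prop :=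
  ∀ i j, (A i j).IsHomogeneous e

variable {α β γ : Type*} [Fintype β] [Fintype γ]

theorem vecComponent_mulVec_of_le {A : Matrix α β (MvPolynomial σ K)} {e D : ℕ}
    (hA : HomogeneousEntries A e) (hD : e ≤ D) (v : β → MvPolynomial σ K) :
    vecComponent D (A *ᵥ v) = A *ᵥ vecComponent (D - e) v := by
  ext1 i
  simp only [vecComponent, mulVec, dotProduct, map_sum]
  exact Finset.sum_congr rfl fun j _ => homogeneousComponent_mul_of_le (hA i j) hD _

theorem vecComponent_mulVec_of_lt {A : Matrix α β (MvPolynomial σ K)} {e D : ℕ}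
    (hA : HomogeneousEntries A e) (hD : D < e) (v : β → MvPolynomial σ K) :
    vecComponent D (A *ᵥ v) = 0 := by
  ext1 i
  simp only [vecComponent, mulVec, dotProduct, map_sum]
  exact Finset.sum_eq_zero fun j _ => homogeneousComponent_mul_of_lt (hA i j) hD _

theorem isGraded_ker {A : Matrix α β (MvPolynomial σ K)} {e : ℕ} (hA : HomogeneousEntries A e) :
    IsGraded (LinearMap.ker A.mulVecLin) := by
  intro v hv D
  rw [LinearMap.mem_ker, mulVecLin_apply] at hv ⊢
  have h := vecComponent_mulVec_of_le hA (Nat.le_add_left e D) v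
  rw [Nat.add_sub_cancel, hv] at h
  rw [← h]
  ext1 i
  simp [vecComponent]

theorem mem_of_vecComponent_mem {N : Submodule (MvPolynomial σ K) (β → MvPolynomial σ K)}
    {v : β → MvPolynomial σ K} (h : ∀ D, vecComponent D v ∈ N) : v ∈ N := by
  have hv : v = ∑ D ∈ Finset.range (Finset.univ.sup (fun j => (v j).totalDegree) + 1),
      vecComponent D v := by
    ext1 j
    rw [Finset.sum_apply]
    conv_lhs => rw [← sum_homogeneousComponent (v j)]
    refine Finset.sum_subset (Finset.range_mono ?_) fun D _ hD => ?_
    · exact Nat.succ_le_succ (Finset.le_sup (f := fun j => (v j).totalDegree) (Finset.mem_univ j))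
    · exact homogeneousComponent_eq_zero _ _ (by simpa using hD)
  rw [hv]
  exact Submodule.sum_mem _ fun D _ => h D

/-- A graded form of Nakayama's lemma. -/
theorem le_range_of_forall_exists_add_smul {N : Submodule (MvPolynomial σ K) (β → MvPolynomial σ K)}
    {B : Matrix β γ (MvPolynomial σ K)} {e : ℕ} (hB : HomogeneousEntries B e)
    {l : MvPolynomial σ K} (hl : l.IsHomogeneous 1)
    (h : ∀ v ∈ N, ∃ w, ∃ z ∈ N, v = B *ᵥ w + l • z) : N ≤ LinearMap.range B.mulVecLin := by
  have hpow (n : ℕ) : ∀ v ∈ N, ∃ w, ∃ z ∈ N, v = B *ᵥ w + l ^ n • z := by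
    induction n with
    | zero => exact fun v hv => ⟨0, v, hv, by simp⟩
    | succ n ih =>
      intro v hv
      obtain ⟨w, z, hz, rfl⟩ := ih v hv
      obtain ⟨w', z', hz', rfl⟩ := h z hz
      refine ⟨w + l ^ n • w', z', hz', ?_⟩
      rw [mulVec_add, mulVec_smul, smul_add, smul_smul, ← pow_succ, add_assoc]
  intro v hv
  refine mem_of_vecComponent_mem fun D => ?_
  obtain ⟨w, z, -, rfl⟩ := hpow (D + 1) v hv
  have hzero : vecComponent D (B *ᵥ w + l ^ (D + 1) • z) = vecComponent D (B *ᵥ w) := by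
    ext1 j
    simp only [vecComponent, Pi.add_apply, Pi.smul_apply, smul_eq_mul, map_add]
    rw [homogeneousComponent_mul_of_lt (hl.pow (D + 1)) (by omega), add_zero]
  rw [hzero]
  rcases le_or_gt e D with hD | hD
  · rw [vecComponent_mulVec_of_le hB hD]
    exact ⟨_, rfl⟩
  · rw [vecComponent_mulVec_of_lt hB hD]
    exact Submodule.zero_mem _

end Homogeneous

section Reformulation

variable {K : Type*} [Field K] {σ : Type*}

/-- An ideal viewed as a submodule of the free module of rank one. -/
def idealVec {R : Type*} [CommRing R] (I : Ideal R) : Submodule R (Unit → R) :=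
  Submodule.comap (LinearMap.proj (R := R) (φ := fun _ : Unit => R) ()) I

theorem mem_idealVec {R : Type*} [CommRing R] {I : Ideal R} {v : Unit → R} :
    v ∈ idealVec I ↔ v () ∈ I := Iff.rfl

theorem range_mulVecLin_row {R : Type*} [CommRing R] {β : Type*} [Fintype β]
    (g : Matrix Unit β R) :
    LinearMap.range g.mulVecLin = idealVec (Ideal.span (Set.range (g ()))) := by
  ext v
  rw [mem_idealVec, Ideal.mem_span_range_iff_exists_fun, LinearMap.mem_range]
  refine exists_congr fun c => ⟨fun h => ?_, fun h => ?_⟩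
  · rw [← h]
    simp [mulVec, dotProduct, mul_comm]
  · ext1
    rw [← h]
    simp [mulVec, dotProduct, mul_comm]

theorem idealVec_injective {R : Type*} [CommRing R] :
    Function.Injective (idealVec : Ideal R → _) := by
  intro I J h
  ext x
  exact SetLike.ext_iff.mp h fun _ => x

theorem hasLinearResolution_iff_matrix {I : Ideal (MvPolynomial σ K)} {d : ℕ} :
    HasLinearResolution I d ↔ ∃ (r : ℕ → ℕ) (G : Matrix Unit (Fin (r 0)) (MvPolynomial σ K))
      (M : (i : ℕ) → Matrix (Fin (r i)) (Fin (r (i + 1))) (MvPolynomial σ K)),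
      HomogeneousEntries G d ∧ idealVec I = LinearMap.range G.mulVecLin ∧
      (∀ i, HomogeneousEntries (M i) 1) ∧
      LinearMap.ker G.mulVecLin = LinearMap.range (M 0).mulVecLin ∧
      ∀ i, LinearMap.ker (M i).mulVecLin = LinearMap.range (M (i + 1)).mulVecLin := by
  have hrange {b c : ℕ} (B : Matrix (Fin b) (Fin c) (MvPolynomial σ K)) (v) :
      v ∈ LinearMap.range B.mulVecLin ↔ ∃ w : Fin c → MvPolynomial σ K,
        v = fun j => ∑ k, B j k * w k := by
    rw [LinearMap.mem_range]
    exact exists_congr fun w => eq_comm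
  refine exists_congr fun r => ⟨?_, ?_⟩
  · rintro ⟨g, M, hg, hI, hM, h0, hs⟩
    refine ⟨of fun _ => g, fun i => of (M i), fun _ => hg, ?_, hM, ?_, fun i => ?_⟩
    · rw [range_mulVecLin_row, hI]
      rfl
    · ext v
      refine Iff.trans ?_ ((h0 v).trans (hrange _ v).symm)
      rw [LinearMap.mem_ker, _root_.funext_iff]
      simp [mulVec, dotProduct, mul_comm]
    · ext v
      exact (hs i v).trans (hrange _ v).symm
  · rintro ⟨G, M, hG, hI, hM, h0, hs⟩
    refine ⟨G (), M, hG (), ?_, hM, fun v => ?_, fun i v => ?_⟩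
    · rw [range_mulVecLin_row] at hI
      exact idealVec_injective hI
    · rw [← hrange, ← h0, LinearMap.mem_ker, _root_.funext_iff]
      simp [mulVec, dotProduct, mul_comm, Unique.forall_iff]
    · rw [← hrange, ← hs, LinearMap.mem_ker]
      rfl

end Reformulation

section LinearSection

variable {K : Type*} [Field K] {σ τ : Type*}

/-- `π` is a graded surjection of polynomial rings whose kernel is generated by the nonzero linear
form `l`. -/
structure IsLinearSection (π : MvPolynomial σ K →+* MvPolynomial τ K) (l : MvPolynomial σ K) :
    Prop where
  isHomogeneous : l.IsHomogeneous 1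
  ne_zero : l ≠ 0
  surjective : Function.Surjective π
  map_eq_zero_iff : ∀ p, π p = 0 ↔ l ∣ p
  map_component : ∀ D p, π (homogeneousComponent D p) = homogeneousComponent D (π p)

/-- Multiplication by `l` is injective modulo `N`. -/
def IsSaturated {R : Type*} [CommRing R] {β : Type*} (l : R) (N : Submodule R (β → R)) : Prop :=
  ∀ v, l • v ∈ N → v ∈ N

variable {π : MvPolynomial σ K →+* MvPolynomial τ K} {l : MvPolynomial σ K}
variable {α β γ : Type*} [Fintype β] [Fintype γ]

theorem map_comp_mulVec {R S : Type*} [CommRing R] [CommRing S] (f : R →+* S)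
    (A : Matrix α β R) (v : β → R) : f ∘ (A *ᵥ v) = A.map f *ᵥ (f ∘ v) :=
  funext fun i => RingHom.map_mulVec f A v i

theorem isSaturated_ker {R : Type*} [CommRing R] [IsDomain R] {l : R} (hl : l ≠ 0)
    (A : Matrix α β R) : IsSaturated l (LinearMap.ker A.mulVecLin) := by
  intro v hv
  rw [LinearMap.mem_ker, map_smul] at hv
  exact (smul_eq_zero.mp hv).resolve_left hl

namespace IsLinearSection

theorem exists_eq_smul {δ : Type*} (hπ : IsLinearSection π l) {v : δ → MvPolynomial σ K}
    (hv : π ∘ v = 0) : ∃ u, v = l • u := by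
  choose u hu using fun j => (hπ.map_eq_zero_iff (v j)).mp (congrFun hv j)
  exact ⟨u, funext hu⟩

theorem map_self (hπ : IsLinearSection π l) : π l = 0 :=
  (hπ.map_eq_zero_iff l).mpr dvd_rfl

theorem exists_vec_lift {δ : Type*} (hπ : IsLinearSection π l) (v' : δ → MvPolynomial τ K) :
    ∃ v, π ∘ v = v' := by
  choose v hv using fun j => hπ.surjective (v' j)
  exact ⟨v, funext hv⟩

theorem map_add_smul {δ : Type*} (hπ : IsLinearSection π l) (v z : δ → MvPolynomial σ K) :
    π ∘ (v + l • z) = π ∘ v := by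
  ext1 j
  simp [hπ.map_self]

theorem exists_ker_lift (hπ : IsLinearSection π l) {A : Matrix α β (MvPolynomial σ K)}
    (hA : IsSaturated l (LinearMap.range A.mulVecLin)) {v' : β → MvPolynomial τ K}
    (hv' : A.map π *ᵥ v' = 0) : ∃ v, A *ᵥ v = 0 ∧ π ∘ v = v' := by
  obtain ⟨v, rfl⟩ := hπ.exists_vec_lift v'
  rw [← map_comp_mulVec] at hv'
  obtain ⟨u, hu⟩ := hπ.exists_eq_smul hv'
  obtain ⟨w, hw⟩ := hA u ⟨v, hu⟩
  rw [mulVecLin_apply] at hw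
  refine ⟨v + l • -w, ?_, hπ.map_add_smul _ _⟩
  rw [mulVec_add, mulVec_smul, mulVec_neg, hw, hu, smul_neg, add_neg_cancel]

theorem mem_ker_map_iff (hπ : IsLinearSection π l) {A : Matrix α β (MvPolynomial σ K)}
    (hA : IsSaturated l (LinearMap.range A.mulVecLin)) {v' : β → MvPolynomial τ K} :
    v' ∈ LinearMap.ker (A.map π).mulVecLin ↔
      ∃ v ∈ LinearMap.ker A.mulVecLin, π ∘ v = v' := by
  refine ⟨fun h => hπ.exists_ker_lift hA h, ?_⟩
  rintro ⟨v, hv, rfl⟩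
  rw [LinearMap.mem_ker, mulVecLin_apply] at hv ⊢
  rw [← map_comp_mulVec, hv]
  ext1 i
  simp

theorem mem_range_map_iff {δ : Type*} (hπ : IsLinearSection π l)
    {B : Matrix δ γ (MvPolynomial σ K)} {v' : δ → MvPolynomial τ K} :
    v' ∈ LinearMap.range (B.map π).mulVecLin ↔
      ∃ v ∈ LinearMap.range B.mulVecLin, π ∘ v = v' := by
  constructor
  · rintro ⟨w', rfl⟩
    obtain ⟨w, rfl⟩ := hπ.exists_vec_lift w'
    exact ⟨_, ⟨w, rfl⟩, map_comp_mulVec π B w⟩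
  · rintro ⟨_, ⟨w, rfl⟩, rfl⟩
    exact ⟨π ∘ w, (map_comp_mulVec π B w).symm⟩

theorem ker_map_eq_range_map (hπ : IsLinearSection π l) {A : Matrix α β (MvPolynomial σ K)}
    {B : Matrix β γ (MvPolynomial σ K)} (hA : IsSaturated l (LinearMap.range A.mulVecLin))
    (hAB : LinearMap.ker A.mulVecLin = LinearMap.range B.mulVecLin) :
    LinearMap.ker (A.map π).mulVecLin = LinearMap.range (B.map π).mulVecLin := by
  ext v'
  rw [hπ.mem_ker_map_iff hA, hπ.mem_range_map_iff, hAB]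

theorem homogeneousEntries_map {δ : Type*} (hπ : IsLinearSection π l)
    {A : Matrix α δ (MvPolynomial σ K)} {e : ℕ} (hA : HomogeneousEntries A e) :
    HomogeneousEntries (A.map π) e := by
  intro i j
  rw [map_apply, ← homogeneousComponent_eq_self (hA i j), hπ.map_component]
  exact homogeneousComponent_isHomogeneous _ _

/-- Homogeneous generators of the image of a saturated graded submodule lift to homogeneous
generators. -/
theorem exists_generators_lift (hπ : IsLinearSection π l)
    {N : Submodule (MvPolynomial σ K) (β → MvPolynomial σ K)} (hgr : IsGraded N)
    (hsat : IsSaturated l N) {B' : Matrix β γ (MvPolynomial τ K)} {e : ℕ}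
    (hB' : HomogeneousEntries B' e)
    (hN : ∀ v', v' ∈ LinearMap.range B'.mulVecLin ↔ ∃ v ∈ N, π ∘ v = v') :
    ∃ B : Matrix β γ (MvPolynomial σ K), HomogeneousEntries B e ∧ B.map π = B' ∧
      N = LinearMap.range B.mulVecLin := by
  classical
  have hcol (k : γ) : ∃ c ∈ N, π ∘ c = fun j => B' j k :=
    (hN _).mp ⟨Pi.single k 1, by ext1 j; simp⟩
  choose c hcN hc using hcol
  have hBmap : (of fun j k => vecComponent e (c k) j).map π = B' := by
    ext1 j k
    rw [map_apply, of_apply, vecComponent, hπ.map_component,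
      show π (c k j) = B' j k from congrFun (hc k) j, homogeneousComponent_eq_self (hB' j k)]
  have hBhom : HomogeneousEntries (of fun j k => vecComponent e (c k) j) e :=
    fun j k => homogeneousComponent_isHomogeneous _ _
  refine ⟨of fun j k => vecComponent e (c k) j, hBhom, hBmap, ?_⟩
  have hle : LinearMap.range (of fun j k => vecComponent e (c k) j).mulVecLin ≤ N := by
    rw [range_mulVecLin, Submodule.span_le]
    rintro _ ⟨k, rfl⟩
    exact hgr _ (hcN k) e
  refine le_antisymm (le_range_of_forall_exists_add_smul hBhom hπ.isHomogeneous ?_) hle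
  intro v hv
  obtain ⟨w', hw'⟩ := (hN (π ∘ v)).mpr ⟨v, hv, rfl⟩
  obtain ⟨w, rfl⟩ := hπ.exists_vec_lift w'
  rw [mulVecLin_apply, ← hBmap, ← map_comp_mulVec] at hw'
  obtain ⟨z, hz⟩ := hπ.exists_eq_smul
    (v := v - of (fun j k => vecComponent e (c k) j) *ᵥ w) <| by
      ext1 j
      simpa [sub_eq_zero] using (congrFun hw' j).symm
  refine ⟨w, z, hsat z ?_, by rw [← hz]; abel⟩
  rw [← hz]
  exact N.sub_mem hv (hle ⟨w, rfl⟩)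

end IsLinearSection

theorem exists_dependent_seq {T : ℕ → Type*} {Q : ∀ i, T i → T (i + 1) → Prop} (x : T 0)
    (hs : ∀ i y, ∃ z, Q i y z) : ∃ s : ∀ i, T i, s 0 = x ∧ ∀ i, Q i (s i) (s (i + 1)) := by
  choose f hf using hs
  exact ⟨fun i => Nat.rec x f i, rfl, fun i => hf _ _⟩

theorem hasLinearResolution_map_iff_of_isLinearSection (hπ : IsLinearSection π l)
    {J : Ideal (MvPolynomial σ K)} (hgr : ∀ p ∈ J, ∀ D, homogeneousComponent D p ∈ J)
    (hsat : ∀ p, l * p ∈ J → p ∈ J) (d : ℕ) :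
    HasLinearResolution J d ↔ HasLinearResolution (J.map π) d := by
  rw [hasLinearResolution_iff_matrix, hasLinearResolution_iff_matrix]
  have hsatJ : IsSaturated l (idealVec J) := fun v hv => hsat _ hv
  have hmem (v' : Unit → MvPolynomial τ K) :
      v' ∈ idealVec (J.map π) ↔ ∃ v ∈ idealVec J, π ∘ v = v' := by
    rw [mem_idealVec, Ideal.mem_map_iff_of_surjective π hπ.surjective]
    constructor
    · rintro ⟨p, hp, h⟩
      exact ⟨fun _ => p, hp, funext fun _ => h⟩
    · rintro ⟨v, hv, rfl⟩
      exact ⟨v (), hv, rfl⟩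
  constructor
  · rintro ⟨r, G, M, hG, hJ, hM, h0, hs⟩
    have hsatM (i : ℕ) : IsSaturated l (LinearMap.range (M i).mulVecLin) := by
      cases i with
      | zero => exact h0 ▸ isSaturated_ker hπ.ne_zero G
      | succ i => exact hs i ▸ isSaturated_ker hπ.ne_zero (M i)
    refine ⟨r, G.map π, fun i => (M i).map π, hπ.homogeneousEntries_map hG, ?_,
      fun i => hπ.homogeneousEntries_map (hM i), hπ.ker_map_eq_range_map (hJ ▸ hsatJ) h0,
      fun i => hπ.ker_map_eq_range_map (hsatM i) (hs i)⟩
    ext v'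
    rw [hmem, hπ.mem_range_map_iff, hJ]
  · rintro ⟨r, G', M', hG', hJ', hM', h0', hs'⟩
    obtain ⟨G, hG, rfl, hJ⟩ := hπ.exists_generators_lift (N := idealVec J)
      (fun v hv D => hgr _ hv D) hsatJ hG' (fun v' => by rw [← hJ', hmem])
    have hstep {a b c : Type} [Fintype a] [Fintype b] [Fintype c] {e : ℕ}
        (A : Matrix a b (MvPolynomial σ K)) (B' : Matrix b c (MvPolynomial τ K))
        (hA : HomogeneousEntries A e) (hAsat : IsSaturated l (LinearMap.range A.mulVecLin))
        (hB' : HomogeneousEntries B' 1)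
        (h : LinearMap.ker (A.map π).mulVecLin = LinearMap.range B'.mulVecLin) :
        ∃ B : Matrix b c (MvPolynomial σ K), (HomogeneousEntries B 1 ∧ B.map π = B' ∧
          IsSaturated l (LinearMap.range B.mulVecLin)) ∧
          LinearMap.ker A.mulVecLin = LinearMap.range B.mulVecLin := by
      obtain ⟨B, hB, hBm, hAB⟩ := hπ.exists_generators_lift (isGraded_ker hA)
        (isSaturated_ker hπ.ne_zero A) hB'
        (fun v' => by rw [← h, hπ.mem_ker_map_iff hAsat])
      exact ⟨B, ⟨hB, hBm, hAB ▸ isSaturated_ker hπ.ne_zero A⟩, hAB⟩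
    obtain ⟨M₀, hM₀, hGM⟩ := hstep G (M' 0) hG (hJ ▸ hsatJ) (hM' 0) h0'
    obtain ⟨M, hMzero, hM⟩ := exists_dependent_seq
      (T := fun i => {B : Matrix (Fin (r i)) (Fin (r (i + 1))) (MvPolynomial σ K) //
        HomogeneousEntries B 1 ∧ B.map π = M' i ∧ IsSaturated l (LinearMap.range B.mulVecLin)})
      (Q := fun i A B => LinearMap.ker A.1.mulVecLin = LinearMap.range B.1.mulVecLin)
      ⟨M₀, hM₀⟩ fun i A => by
        obtain ⟨B, hB, hAB⟩ := hstep A.1 (M' (i + 1)) A.2.1 A.2.2.2 (hM' (i + 1))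
          (by rw [A.2.2.1]; exact hs' i)
        exact ⟨⟨B, hB⟩, hAB⟩
    refine ⟨r, G, fun i => (M i).1, hG, hJ, fun i => (M i).2.1, ?_, hM⟩
    simpa only [hMzero] using hGM

end LinearSection

section Merge

variable {K : Type*} [Field K] {σ : Type*}

/-- The ideal generated by the monomials with exponents in `E`. -/
noncomputable abbrev monomialIdeal (K : Type*) [Field K] {σ : Type*} (E : Set (σ →₀ ℕ)) :
    Ideal (MvPolynomial σ K) :=
  Ideal.span ((fun a => monomial a (1 : K)) '' E)

theorem map_rename_monomialIdeal {τ : Type*} (f : σ → τ) (E : Set (σ →₀ ℕ)) :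
    (monomialIdeal K E).map (rename f : MvPolynomial σ K →ₐ[K] MvPolynomial τ K).toRingHom =
      monomialIdeal K (Finsupp.mapDomain f '' E) := by
  simp [monomialIdeal, Ideal.map_span, Set.image_image, rename_monomial]

theorem homogeneousComponent_mem_monomialIdeal {E : Set (σ →₀ ℕ)} {p : MvPolynomial σ K}
    (hp : p ∈ monomialIdeal K E) (D : ℕ) : homogeneousComponent D p ∈ monomialIdeal K E := by
  rw [mem_ideal_span_monomial_image] at hp ⊢
  intro u hu
  rw [support_homogeneousComponent, Finset.mem_filter] at hu
  exact hp u hu.1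

theorem coeff_eq_zero_of_sub_mul_mem {E : Set (σ →₀ ℕ)} {s t : σ} (hst : s ≠ t)
    {p : MvPolynomial σ K} (hp : (X s - X t) * p ∈ monomialIdeal K E) (k : ℕ) :
    ∀ u : σ →₀ ℕ, u s = k →
      (∀ j ≤ k, ∀ a ∈ E, ¬ a ≤ u - Finsupp.single s j + Finsupp.single t (j + 1)) →
      coeff u p = 0 := by
  classical
  rw [mem_ideal_span_monomial_image] at hp
  have hcoeff (u : σ →₀ ℕ) (hu : ∀ a ∈ E, ¬ a ≤ u) : coeff u (X s * p) = coeff u (X t * p) := by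
    by_contra h
    obtain ⟨a, ha, hau⟩ := hp u (by rwa [mem_support_iff, sub_mul, coeff_sub, sub_ne_zero])
    exact hu a ha hau
  induction k with
  | zero =>
    intro u hu h
    have := hcoeff (u + Finsupp.single t 1) (by simpa using h 0 le_rfl)
    rw [coeff_X_mul', coeff_X_mul', if_neg, if_pos (by simp)] at this
    · simpa using this.symm
    · simp [hu, hst.symm]
  | succ k ih =>
    intro u hu h
    have := hcoeff (u + Finsupp.single t 1) (by simpa using h 0 (Nat.zero_le _))
    rw [coeff_X_mul', coeff_X_mul', if_pos (by simp [hu]), if_pos (by simp), add_tsub_cancel_right]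
      at this
    rw [← this]
    refine ih _ (by simp [hu, hst]) fun j hj a ha hle => ?_
    refine h (j + 1) (by omega) a ha (hle.trans (le_of_eq ?_))
    ext i
    simp only [Finsupp.add_apply, Finsupp.tsub_apply, Finsupp.single_apply]
    split_ifs <;> grind

/-- If the exponents of `X s` and of `X t` in the generators never vary in opposite directions,
then `X s - X t` is a nonzerodivisor modulo the monomial ideal. -/
theorem mem_of_sub_mul_mem {E : Set (σ →₀ ℕ)} {s t : σ} (hst : s ≠ t)
    (hE : ∀ a ∈ E, ∀ b ∈ E, a s ≤ b s ∨ b t ≤ a t) {p : MvPolynomial σ K}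
    (hp : (X s - X t) * p ∈ monomialIdeal K E) : p ∈ monomialIdeal K E := by
  classical
  rw [mem_ideal_span_monomial_image]
  intro u hu
  by_contra! hnot
  rw [mem_support_iff] at hu
  have hp' : (X t - X s) * p ∈ monomialIdeal K E := by
    rw [← neg_sub, neg_mul]
    exact neg_mem hp
  have h₁ := mt (coeff_eq_zero_of_sub_mul_mem hst hp _ u rfl) hu
  have h₂ := mt (coeff_eq_zero_of_sub_mul_mem hst.symm hp' _ u rfl) hu
  push Not at h₁ h₂
  obtain ⟨j, hj, a, ha, hau⟩ := h₁
  obtain ⟨k, hk, b, hb, hbu⟩ := h₂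
  have hagree (c : σ →₀ ℕ) (hc : c ∈ E) (hs : c s ≤ u s) (ht : c t ≤ u t)
      (hr : ∀ i, i ≠ s → i ≠ t → c i ≤ u i) : False := by
    refine hnot c hc fun i => ?_
    by_cases his : i = s
    · exact his ▸ hs
    · by_cases hit : i = t
      · exact hit ▸ ht
      · exact hr i his hit
  have ha' (i : σ) := hau i
  have hb' (i : σ) := hbu i
  simp only [Finsupp.add_apply, Finsupp.tsub_apply, Finsupp.single_apply] at ha' hb'
  have has := ha' s
  have hat := ha' t
  have hbs := hb' s
  have hbt := hb' t
  simp only [if_neg hst, if_neg hst.symm, if_true] at has hat hbs hbt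
  have hat' : u t < a t := by
    by_contra! hle
    exact hagree a ha (by omega) hle fun i hs ht => by
      simpa [hs.symm, ht.symm] using ha' i
  have hbs' : u s < b s := by
    by_contra! hle
    exact hagree b hb hle (by omega) fun i hs ht => by
      simpa [hs.symm, ht.symm] using hb' i
  rcases hE b hb a ha with h | h <;> omega

open Classical in
/-- The map identifying `s` with the element `t ≠ s`. -/
noncomputable def mergeMap {s t : σ} (hst : s ≠ t) (i : σ) : {i : σ // i ≠ s} :=
  if h : i = s then ⟨t, hst.symm⟩ else ⟨i, h⟩

theorem mergeMap_self {s t : σ} (hst : s ≠ t) : mergeMap hst s = ⟨t, hst.symm⟩ := by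
  simp [mergeMap]

theorem mergeMap_of_ne {s t : σ} (hst : s ≠ t) {i : σ} (hi : i ≠ s) : mergeMap hst i = ⟨i, hi⟩ := by
  simp [mergeMap, hi]

theorem isLinearSection_rename_mergeMap {s t : σ} (hst : s ≠ t) :
    IsLinearSection (rename (mergeMap hst) :
      MvPolynomial σ K →ₐ[K] MvPolynomial {i : σ // i ≠ s} K).toRingHom (X s - X t) where
  isHomogeneous := (isHomogeneous_X K s).sub (isHomogeneous_X K t)
  ne_zero := sub_ne_zero.mpr fun h => hst (X_injective h)
  surjective := rename_surjective _ fun i => ⟨i.1, mergeMap_of_ne hst i.2⟩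
  map_eq_zero_iff p := by
    constructor
    · intro hp
      have hmk : (Ideal.Quotient.mkₐ K (Ideal.span {X s - X t})).comp
          ((rename Subtype.val).comp (rename (mergeMap hst))) =
          Ideal.Quotient.mkₐ K (Ideal.span {(X s - X t : MvPolynomial σ K)}) := by
        ext i
        by_cases hi : i = s
        · subst hi
          simp only [AlgHom.comp_apply, rename_X, mergeMap_self, Ideal.Quotient.mkₐ_eq_mk]
          rw [eq_comm, Ideal.Quotient.eq]
          exact Ideal.mem_span_singleton_self _
        · simp [mergeMap_of_ne hst hi]
      have h := DFunLike.congr_fun hmk p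
      replace hp : rename (mergeMap hst) p = 0 := hp
      rw [AlgHom.comp_apply, AlgHom.comp_apply, hp, map_zero, map_zero, eq_comm,
        Ideal.Quotient.mkₐ_eq_mk, Ideal.Quotient.eq_zero_iff_mem, Ideal.mem_span_singleton] at h
      exact h
    · rintro ⟨q, rfl⟩
      simp [mergeMap_self, mergeMap_of_ne hst hst.symm]
  map_component D p := by
    change rename (mergeMap hst) _ = homogeneousComponent D (rename (mergeMap hst) p)
    rw [rename_homogeneousComponent]

end Merge

section Extension

variable {K : Type*} [Field K] {σ τ : Type*} {α β γ : Type*} [Fintype β] [Fintype γ]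

theorem exists_ringEquiv_rename_eq_C {f : σ → τ} (hf : Function.Injective f) :
    ∃ (ρ : Set τ) (φ : MvPolynomial τ K ≃+* MvPolynomial ρ (MvPolynomial σ K)),
      ∀ p, φ (rename f p) = C p := by
  classical
  let e : τ ≃ ↥(Set.range f)ᶜ ⊕ σ :=
    ((Equiv.sumComm _ _).trans ((Equiv.sumCongr (Equiv.ofInjective f hf)
      (Equiv.refl _)).trans (Equiv.Set.sumCompl (Set.range f)))).symm
  have he (x : σ) : e (f x) = Sum.inr x := by
    rw [Equiv.symm_apply_eq]
    simp
  let φ := (renameEquiv K e).trans (sumAlgEquiv K ↥(Set.range f)ᶜ σ)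
  refine ⟨(Set.range f)ᶜ, φ.toRingEquiv, fun p => ?_⟩
  change sumAlgEquiv K _ σ (rename e (rename f p)) = C p
  rw [rename_rename, show ⇑e ∘ f = Sum.inr from funext he]
  exact DFunLike.congr_fun (sumAlgEquiv_comp_rename_inr K _ σ) p

theorem coeff_map_C_mulVec {R ρ : Type*} [CommRing R] (A : Matrix α β R)
    (v : β → MvPolynomial ρ R) (m : ρ →₀ ℕ) :
    coeff m ∘ (A.map C *ᵥ v) = A *ᵥ (coeff m ∘ v) := by
  ext1 i
  simp [mulVec, dotProduct, coeff_sum, coeff_C_mul]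

theorem ker_map_C_eq_range {R ρ : Type*} [CommRing R] {A : Matrix α β R} {B : Matrix β γ R}
    (h : LinearMap.ker A.mulVecLin = LinearMap.range B.mulVecLin) :
    LinearMap.ker (A.map (C (σ := ρ))).mulVecLin =
      LinearMap.range (B.map (C (σ := ρ))).mulVecLin := by
  classical
  ext v
  rw [LinearMap.mem_ker, mulVecLin_apply, LinearMap.mem_range]
  constructor
  · intro hv
    have hcoeff (m : ρ →₀ ℕ) : ∃ w, B *ᵥ w = coeff m ∘ v := by
      have : coeff m ∘ v ∈ LinearMap.ker A.mulVecLin := by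
        rw [LinearMap.mem_ker, mulVecLin_apply, ← coeff_map_C_mulVec, hv]
        ext1 i
        simp
      rw [h] at this
      exact this
    choose w hw using hcoeff
    let S := Finset.univ.biUnion fun j => (v j).support
    refine ⟨fun k => ∑ m ∈ S, monomial m (w m k), ?_⟩
    ext1 j
    ext m
    have hcomp : coeff m ∘ (fun k => ∑ m ∈ S, monomial m (w m k)) =
        if m ∈ S then w m else 0 := by
      ext1 k
      simp only [Function.comp_apply, coeff_sum, coeff_monomial, Finset.sum_ite_eq']
      split_ifs <;> rfl
    have hj := congrFun (coeff_map_C_mulVec B (fun k => ∑ m ∈ S, monomial m (w m k)) m) j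
    rw [hcomp, Function.comp_apply] at hj
    rw [mulVecLin_apply, hj]
    split_ifs with hm
    · exact congrFun (hw m) j
    · rw [mulVec_zero, Pi.zero_apply, eq_comm, ← notMem_support_iff]
      exact fun hmem => hm (Finset.mem_biUnion.mpr ⟨j, Finset.mem_univ j, hmem⟩)
  · rintro ⟨w, rfl⟩
    ext1 i
    ext m
    have hmem : B *ᵥ (coeff m ∘ w) ∈ LinearMap.ker A.mulVecLin := by
      rw [h]
      exact ⟨_, rfl⟩
    rw [LinearMap.mem_ker, mulVecLin_apply, ← coeff_map_C_mulVec, ← coeff_map_C_mulVec] at hmem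
    exact congrFun hmem i

/-- Extension of variables preserves exactness. -/
theorem ker_map_rename_eq_range {f : σ → τ} (hf : Function.Injective f)
    {A : Matrix α β (MvPolynomial σ K)} {B : Matrix β γ (MvPolynomial σ K)}
    (h : LinearMap.ker A.mulVecLin = LinearMap.range B.mulVecLin) :
    LinearMap.ker (A.map (rename f).toRingHom).mulVecLin =
      LinearMap.range (B.map (rename f).toRingHom).mulVecLin := by
  obtain ⟨ρ, φ, hφ⟩ := exists_ringEquiv_rename_eq_C (K := K) hf
  have hA : (A.map (rename f).toRingHom).map φ = A.map C := by
    ext1 i j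
    exact hφ _
  have hB : (B.map (rename f).toRingHom).map φ = B.map C := by
    ext1 i j
    exact hφ _
  have hφA (v) := map_comp_mulVec φ.toRingHom (A.map (rename f).toRingHom) v
  have hφB (v) := map_comp_mulVec φ.toRingHom (B.map (rename f).toRingHom) v
  simp only [RingEquiv.toRingHom_eq_coe, RingHom.coe_coe, hA, hB] at hφA hφB
  have hexact := ker_map_C_eq_range (ρ := ρ) h
  ext v
  have hker : v ∈ LinearMap.ker (A.map (rename f).toRingHom).mulVecLin ↔
      φ ∘ v ∈ LinearMap.ker (A.map (C (σ := ρ))).mulVecLin := by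
    rw [LinearMap.mem_ker, LinearMap.mem_ker, mulVecLin_apply, mulVecLin_apply, ← hφA,
      _root_.funext_iff, _root_.funext_iff]
    simp
  rw [hker, hexact]
  constructor
  · rintro ⟨w, hw⟩
    refine ⟨φ.symm ∘ w, φ.injective.comp_left ?_⟩
    simp only [← hw, mulVecLin_apply, hφB]
    congr 1
    ext1 k
    simp
  · rintro ⟨w, rfl⟩
    exact ⟨φ ∘ w, (hφB w).symm⟩

theorem ker_eq_range_of_map_rename {f : σ → τ} (hf : Function.Injective f)
    {A : Matrix α β (MvPolynomial σ K)} {B : Matrix β γ (MvPolynomial σ K)}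
    (h : LinearMap.ker (A.map (rename f).toRingHom).mulVecLin =
      LinearMap.range (B.map (rename f).toRingHom).mulVecLin) :
    LinearMap.ker A.mulVecLin = LinearMap.range B.mulVecLin := by
  have hinj : Function.Injective (rename f : MvPolynomial σ K →ₐ[K] _).toRingHom :=
    rename_injective f hf
  have hretr (p : MvPolynomial σ K) :
      (killCompl hf).toRingHom ((rename f).toRingHom p) = p := killCompl_rename_app hf p
  have hB : (B.map (rename f).toRingHom).map (killCompl hf).toRingHom = B := by
    ext1 i j
    exact hretr _
  ext v
  have hker : v ∈ LinearMap.ker A.mulVecLin ↔ (rename f).toRingHom ∘ v ∈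
      LinearMap.ker (A.map (rename f).toRingHom).mulVecLin := by
    rw [LinearMap.mem_ker, LinearMap.mem_ker, mulVecLin_apply, mulVecLin_apply, ← map_comp_mulVec,
      _root_.funext_iff, _root_.funext_iff]
    exact forall_congr' fun i => (map_eq_zero_iff _ hinj).symm
  rw [hker, h]
  constructor
  · rintro ⟨w, hw⟩
    refine ⟨(killCompl hf).toRingHom ∘ w, ?_⟩
    rw [mulVecLin_apply] at hw ⊢
    have := congrArg ((killCompl hf).toRingHom ∘ ·) hw
    simp only [map_comp_mulVec, hB] at this
    rw [this]
    ext1 j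
    exact hretr _
  · rintro ⟨w, rfl⟩
    exact ⟨(rename f).toRingHom ∘ w, (map_comp_mulVec _ B w).symm⟩

/-- The quotient of a polynomial by the variable `X s`, as an additive map. -/
noncomputable def divX (s : τ) : MvPolynomial τ K →+ MvPolynomial τ K :=
  AddMonoidHom.mk' (fun p => p.divMonomial (Finsupp.single s 1)) fun p q => add_divMonomial p q _

theorem coeff_divX (s : τ) (p : MvPolynomial τ K) (m : τ →₀ ℕ) :
    coeff m (divX s p) = coeff (Finsupp.single s 1 + m) p :=
  coeff_divMonomial _ _ _

theorem divX_rename_mul {f : σ → τ} {s : τ} (hs : s ∉ Set.range f) (a : MvPolynomial σ K)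
    (t : MvPolynomial τ K) : divX s (rename f a * t) = rename f a * divX s t := by
  classical
  induction a using MvPolynomial.induction_on generalizing t with
  | C c =>
    ext m
    simp [coeff_divX, coeff_C_mul]
  | add p q hp hq => rw [map_add, add_mul, map_add, hp, hq, add_mul]
  | mul_X p i hp =>
    rw [map_mul (rename f), rename_X, mul_assoc, hp, mul_assoc]
    congr 1
    have his : f i ≠ s := fun h => hs ⟨i, h⟩
    ext m
    rw [coeff_divX, coeff_X_mul', coeff_X_mul', coeff_divX]
    by_cases hm : f i ∈ m.support
    · rw [if_pos hm, if_pos (by rw [Finsupp.mem_support_iff] at hm ⊢; simp [hm])]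
      congr 1
      refine add_tsub_assoc_of_le ?_ _
      rw [Finsupp.single_le_iff]
      exact Nat.one_le_iff_ne_zero.mpr (Finsupp.mem_support_iff.mp hm)
    · rw [if_neg hm, if_neg]
      rw [Finsupp.notMem_support_iff] at hm ⊢
      simp [hm, his]

theorem exists_rename_eq_of_divX_eq_zero {f : σ → τ} (hf : Function.Injective f)
    {p : MvPolynomial τ K} (hp : ∀ s ∉ Set.range f, divX s p = 0) : ∃ q, rename f q = p := by
  refine exists_rename_eq_of_vars_subset_range p f hf fun s hs => ?_
  by_contra hsf
  obtain ⟨m, hm, hms⟩ := mem_vars_iff_mem_support s |>.mp hs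
  have h := congrArg (coeff (m - Finsupp.single s 1)) (hp s hsf)
  rw [coeff_divX, add_tsub_cancel_of_le, coeff_zero] at h
  · exact mem_support_iff.mp hm h
  · rw [Finsupp.single_le_iff]
    exact Nat.one_le_iff_ne_zero.mpr (Finsupp.mem_support_iff.mp hms)

/-- Homogeneous generators, all of the same degree, of a module extended from the polynomial ring
in fewer variables have entries in the smaller ring. -/
theorem exists_eq_map_rename {f : σ → τ} (hf : Function.Injective f)
    {B : Matrix β γ (MvPolynomial τ K)} {e : ℕ} (hB : HomogeneousEntries B e)
    (hdiv : ∀ s ∉ Set.range f, ∀ v ∈ LinearMap.range B.mulVecLin,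
      divX s ∘ v ∈ LinearMap.range B.mulVecLin) :
    ∃ B' : Matrix β γ (MvPolynomial σ K), HomogeneousEntries B' e ∧
      B = B'.map (rename f).toRingHom := by
  classical
  have hzero (s : τ) (hs : s ∉ Set.range f) (k : γ) : divX s ∘ (fun j => B j k) = 0 := by
    obtain ⟨w, hw⟩ := hdiv s hs (fun j => B j k) ⟨Pi.single k 1, by ext1 j; simp⟩
    rw [mulVecLin_apply] at hw
    refine (Submodule.mem_bot (MvPolynomial τ K)).mp (mem_of_vecComponent_mem fun D => ?_)
    rw [Submodule.mem_bot]
    rcases lt_or_ge D e with hD | hD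
    · rw [← hw, vecComponent_mulVec_of_lt hB hD]
    · ext1 j
      ext m
      simp only [vecComponent, Function.comp_apply, coeff_homogeneousComponent, coeff_divX,
        Pi.zero_apply, coeff_zero, ite_eq_right_iff]
      intro hm
      refine (hB j k).coeff_eq_zero ?_
      rw [map_add, hm, Finsupp.degree_single]
      omega
  choose B' hB' using fun j k => exists_rename_eq_of_divX_eq_zero hf (p := B j k)
    fun s hs => congrFun (hzero s hs k) j
  refine ⟨of B', fun j k => ?_, ?_⟩
  · rw [← IsHomogeneous.rename_isHomogeneous_iff hf, of_apply, hB']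
    exact hB j k
  · ext1 j k
    exact (hB' j k).symm

theorem divX_comp_mem_ker {f : σ → τ} {s : τ} (hs : s ∉ Set.range f)
    (A : Matrix α β (MvPolynomial σ K)) {v : β → MvPolynomial τ K}
    (hv : v ∈ LinearMap.ker (A.map (rename f).toRingHom).mulVecLin) :
    divX s ∘ v ∈ LinearMap.ker (A.map (rename f).toRingHom).mulVecLin := by
  rw [LinearMap.mem_ker, mulVecLin_apply] at hv ⊢
  ext1 i
  have h := congrArg (divX s) (congrFun hv i)
  simp only [mulVec, dotProduct, map_apply, map_sum, Pi.zero_apply, map_zero] at h ⊢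
  rw [← h]
  exact Finset.sum_congr rfl fun j _ => (divX_rename_mul hs _ _).symm

theorem divX_mem_map_rename {f : σ → τ} {s : τ} (hs : s ∉ Set.range f)
    {I : Ideal (MvPolynomial σ K)} {p : MvPolynomial τ K} (hp : p ∈ I.map (rename f).toRingHom) :
    divX s p ∈ I.map (rename f).toRingHom := by
  suffices h : ∀ t, divX s (t * p) ∈ I.map (rename f).toRingHom by simpa using h 1
  refine Submodule.span_induction ?_ ?_ ?_ ?_ hp
  · rintro _ ⟨a, ha, rfl⟩ t
    rw [mul_comm]
    exact (divX_rename_mul hs a t) ▸ Ideal.mul_mem_right _ _ (Ideal.mem_map_of_mem _ ha)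
  · simp
  · intro x y _ _ hx hy t
    rw [mul_add, map_add]
    exact add_mem (hx t) (hy t)
  · intro a x _ hx t
    rw [smul_eq_mul, ← mul_assoc]
    exact hx _

theorem comap_map_rename {f : σ → τ} (hf : Function.Injective f) (I : Ideal (MvPolynomial σ K)) :
    (I.map (rename f).toRingHom).comap (rename f).toRingHom = I := by
  refine le_antisymm (fun p hp => ?_) Ideal.le_comap_map
  have h := Ideal.mem_map_of_mem (killCompl hf).toRingHom (Ideal.mem_comap.mp hp)
  have hid : (killCompl hf).toRingHom.comp (rename f : MvPolynomial σ K →ₐ[K] _).toRingHom =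
      RingHom.id _ := RingHom.ext (killCompl_rename_app hf)
  rw [Ideal.map_map, ← RingHom.comp_apply, hid, Ideal.map_id] at h
  exact h

theorem hasLinearResolution_map_rename_iff {f : σ → τ} (hf : Function.Injective f)
    (I : Ideal (MvPolynomial σ K)) (d : ℕ) :
    HasLinearResolution I d ↔ HasLinearResolution (I.map (rename f).toRingHom) d := by
  rw [hasLinearResolution_iff_matrix, hasLinearResolution_iff_matrix]
  have hspan {c : ℕ} (G : Matrix Unit (Fin c) (MvPolynomial σ K)) :
      LinearMap.range (G.map (rename f).toRingHom).mulVecLin =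
        idealVec ((Ideal.span (Set.range (G ()))).map (rename f).toRingHom) := by
    rw [range_mulVecLin_row, Ideal.map_span, ← Set.range_comp]
    rfl
  constructor
  · rintro ⟨r, G, M, hG, hI, hM, h0, hs⟩
    refine ⟨r, G.map (rename f).toRingHom, fun i => (M i).map (rename f).toRingHom,
      fun i j => (hG i j).rename_isHomogeneous, ?_, fun i j k => (hM i j k).rename_isHomogeneous,
      ker_map_rename_eq_range hf h0, fun i => ker_map_rename_eq_range hf (hs i)⟩
    rw [range_mulVecLin_row] at hI
    rw [hspan, idealVec_injective hI]
  · rintro ⟨r, G', M', hG', hI', hM', h0', hs'⟩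
    obtain ⟨G, hG, rfl⟩ := exists_eq_map_rename hf hG' fun s hs v hv => by
      rw [← hI'] at hv ⊢
      exact divX_mem_map_rename hs hv
    have hM (i : ℕ) : ∃ M : Matrix (Fin (r i)) (Fin (r (i + 1))) (MvPolynomial σ K),
        HomogeneousEntries M 1 ∧ M' i = M.map (rename f).toRingHom := by
      induction i with
      | zero =>
        refine exists_eq_map_rename hf (hM' 0) fun s hs v hv => ?_
        rw [← h0'] at hv ⊢
        exact divX_comp_mem_ker hs G hv
      | succ i ih =>
        obtain ⟨M, -, hM⟩ := ih
        refine exists_eq_map_rename hf (hM' (i + 1)) fun s hs v hv => ?_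
        rw [← hs' i, hM] at hv ⊢
        exact divX_comp_mem_ker hs M hv
    choose M hMhom hM using hM
    refine ⟨r, G, M, hG, ?_, hMhom, ker_eq_range_of_map_rename hf (hM 0 ▸ h0'),
      fun i => ker_eq_range_of_map_rename hf (hM i ▸ hM (i + 1) ▸ hs' i)⟩
    rw [hspan] at hI'
    rw [range_mulVecLin_row, ← comap_map_rename hf I, idealVec_injective hI', comap_map_rename hf]

end Extension

section Polarization

variable {K : Type*} [Field K]

theorem mapDomain_mergeMap_apply {σ : Type*} [DecidableEq σ] {s t : σ} (hst : s ≠ t) (a : σ →₀ ℕ)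
    (i : {i : σ // i ≠ s}) :
    Finsupp.mapDomain (mergeMap hst) a i = a i + if i.1 = t then a s else 0 := by
  induction a using Finsupp.induction_linear with
  | zero => simp
  | add a b ha hb =>
    rw [Finsupp.mapDomain_add, Finsupp.add_apply, ha, hb]
    simp only [Finsupp.add_apply]
    split_ifs <;> omega
  | single j c =>
    obtain ⟨i, hi⟩ := i
    rw [Finsupp.mapDomain_single]
    by_cases hj : j = s
    · subst hj
      simp [mergeMap_self, Finsupp.single_apply, hi.symm, eq_comm]
    · simp [mergeMap_of_ne hst hj, Finsupp.single_apply, hj]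

/-- Variables whose exponents in the generators never vary in opposite directions may be identified
without affecting linearity of the resolution. -/
theorem hasLinearResolution_mapDomain_iff {σ τ : Type*} [Finite σ] (f : σ → τ)
    (E : Set (σ →₀ ℕ))
    (hE : ∀ s t, f s = f t → ∀ a ∈ E, ∀ b ∈ E, a s ≤ b s ∨ b t ≤ a t) (d : ℕ) :
    HasLinearResolution (monomialIdeal K E) d ↔
      HasLinearResolution (monomialIdeal K (Finsupp.mapDomain f '' E)) d := by
  classical
  induction hn : Nat.card σ using Nat.strong_induction_on generalizing σ with
  | _ n ih =>
  by_cases hf : Function.Injective f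
  · rw [hasLinearResolution_map_rename_iff hf, map_rename_monomialIdeal]
  · simp only [Function.Injective, not_forall] at hf
    obtain ⟨s, t, hfst, hst⟩ := hf
    have hcomp : (fun i : {i : σ // i ≠ s} => f i) ∘ mergeMap hst = f := by
      ext1 i
      by_cases hi : i = s
      · rw [Function.comp_apply, hi, mergeMap_self, hfst]
      · rw [Function.comp_apply, mergeMap_of_ne hst hi]
    rw [hasLinearResolution_map_iff_of_isLinearSection (isLinearSection_rename_mergeMap hst)
      (fun p hp D => homogeneousComponent_mem_monomialIdeal hp D)
      (fun p hp => mem_of_sub_mul_mem hst (hE s t hfst) hp), map_rename_monomialIdeal,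
      ih _ (hn ▸ Finite.card_subtype_lt (x := s) (by simp)) (fun i : {i : σ // i ≠ s} => f i) _ ?_
        rfl, Set.image_image]
    · simp_rw [← Finsupp.mapDomain_comp, hcomp]
    · rintro ⟨i, hi⟩ ⟨j, hj⟩ hij _ ⟨a, ha, rfl⟩ _ ⟨b, hb, rfl⟩
      simp only [mapDomain_mergeMap_apply]
      have hij' := hE i j hij a ha b hb
      by_cases hit : i = t <;> by_cases hjt : j = t
      · simp only [hit, hjt]
        omega
      · have := hE s j (by rw [hfst, ← hit]; exact hij) a ha b hb
        simp only [hit, hjt, if_true, if_false] at hij' ⊢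
        omega
      · have := hE i s (by rw [hfst, ← hjt]; exact hij) a ha b hb
        simp only [hit, hjt, if_true, if_false] at hij' ⊢
        omega
      · simpa only [hit, hjt, if_false, add_zero] using hij'

theorem polarize_apply {n : ℕ} (a : Fin n →₀ ℕ) (i : Fin n) (j : ℕ) :
    polarize a (i, j) = if j < a i then 1 else 0 := by
  classical
  rw [polarize, Finsupp.sum_fintype _ _ (by simp), Finsupp.finsetSum_apply]
  simp only [Finsupp.finsetSum_apply, Finsupp.single_apply, Prod.mk.injEq]
  rw [Finset.sum_eq_single i (fun k _ hk => by simp [hk]) (by simp)]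
  simp

/-- The polarization inside the polynomial ring on `N` copies of each variable. -/
noncomputable def boundedPolarize {n : ℕ} (N : ℕ) (a : Fin n →₀ ℕ) : (Fin n × Fin N) →₀ ℕ :=
  Finsupp.equivFunOnFinite.symm fun x => if (x.2 : ℕ) < a x.1 then 1 else 0

theorem mapDomain_boundedPolarize {n N : ℕ} {a : Fin n →₀ ℕ} (ha : ∀ i, a i ≤ N) :
    Finsupp.mapDomain (Prod.map id Fin.val) (boundedPolarize N a) = polarize a := by
  have hinj : Function.Injective (Prod.map id Fin.val : Fin n × Fin N → Fin n × ℕ) :=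
    Function.injective_id.prodMap Fin.val_injective
  ext ⟨i, j⟩
  rw [polarize_apply]
  by_cases hj : j < N
  · exact Finsupp.mapDomain_apply hinj (boundedPolarize N a) (i, ⟨j, hj⟩)
  · rw [Finsupp.mapDomain_of_notMem_range, if_neg]
    · have := ha i
      omega
    · rintro ⟨⟨_, k⟩, hk⟩
      simp only [Prod.map_apply, id_eq, Prod.mk.injEq] at hk
      exact hj (hk.2 ▸ k.2)

theorem mapDomain_fst_boundedPolarize {n N : ℕ} {a : Fin n →₀ ℕ} (ha : ∀ i, a i ≤ N) :
    Finsupp.mapDomain Prod.fst (boundedPolarize N a) = a := by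
  classical
  rw [← Finsupp.univ_sum_single (boundedPolarize N a), Finsupp.mapDomain_finsetSum]
  simp only [Finsupp.mapDomain_single]
  ext i
  rw [Finsupp.finsetSum_apply, Fintype.sum_prod_type,
    Finset.sum_eq_single i (fun k _ hk => by simp [hk]) (by simp)]
  simp only [boundedPolarize, Finsupp.single_eq_same, Finsupp.equivFunOnFinite_symm_apply_apply]
  rw [Finset.sum_boole, Fin.card_filter_val_lt]
  simpa using ha i

theorem exists_bound_of_antichain {n : ℕ} {A : Set (Fin n →₀ ℕ)}
    (hmin : ∀ a ∈ A, ∀ b ∈ A, a ≤ b → a = b) : ∃ N, ∀ a ∈ A, ∀ i, a i ≤ N := by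
  have hanti : IsAntichain (· ≤ ·) A := fun a ha b hb hab h => hab (hmin a ha b hb h)
  have hfin : A.Finite := hanti.finite_of_partiallyWellOrderedOn (Set.isPWO_of_wellQuasiOrderedLE A)
  obtain ⟨m, hm⟩ := hfin.bddAbove
  refine ⟨∑ i, m i, fun a ha i => (hm ha i).trans ?_⟩
  exact Finset.single_le_sum (f := m) (fun _ _ => Nat.zero_le _) (Finset.mem_univ i)

end Polarization

end LinearResolution

/-- A monomial ideal `I` (with minimal monomial generating set `A`) has a `d`-linear
resolution if and only if its polarization `I^℘` has a `d`-linear resolution. -/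
theorem hasLinearResolution_iff_polarization {K : Type*} [Field K] {n : ℕ}
    (I : Ideal (MvPolynomial (Fin n) K)) (A : Set (Fin n →₀ ℕ))
    (hgen : I = Ideal.span ((fun a => (monomial a (1 : K) : MvPolynomial (Fin n) K)) '' A))
    (hmin : ∀ a ∈ A, ∀ b ∈ A, a ≤ b → a = b) (d : ℕ) :
    HasLinearResolution I d ↔
      HasLinearResolution
        (Ideal.span ((fun a => (monomial (polarize a) (1 : K) :
          MvPolynomial (Fin n × ℕ) K)) '' A)) d := by
  obtain ⟨N, hN⟩ := LinearResolution.exists_bound_of_antichain hmin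
  have hfst : Finsupp.mapDomain Prod.fst '' (LinearResolution.boundedPolarize N '' A) = A := by
    rw [Set.image_image]
    exact (Set.image_congr fun a ha =>
      LinearResolution.mapDomain_fst_boundedPolarize (hN a ha)).trans (Set.image_id A)
  have hpol : Finsupp.mapDomain (Prod.map id Fin.val) '' (LinearResolution.boundedPolarize N '' A) =
      polarize '' A := by
    rw [Set.image_image]
    exact Set.image_congr fun a ha => LinearResolution.mapDomain_boundedPolarize (hN a ha)
  have hinj : Function.Injective (Prod.map id Fin.val : Fin n × Fin N → Fin n × ℕ) :=
    Function.injective_id.prodMap Fin.val_injective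
  have hleft := LinearResolution.hasLinearResolution_mapDomain_iff (K := K) Prod.fst
    (LinearResolution.boundedPolarize N '' A) (by
      rintro ⟨i, j⟩ ⟨i', k⟩ hi _ ⟨a, -, rfl⟩ _ ⟨b, -, rfl⟩
      obtain rfl : i = i' := hi
      simp only [LinearResolution.boundedPolarize, Finsupp.equivFunOnFinite_symm_apply_apply]
      split_ifs <;> omega) d
  have hright := LinearResolution.hasLinearResolution_map_rename_iff hinj
    (LinearResolution.monomialIdeal K (LinearResolution.boundedPolarize N '' A)) d
  rw [hfst] at hleft
  rw [LinearResolution.map_rename_monomialIdeal, hpol, LinearResolution.monomialIdeal,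
    LinearResolution.monomialIdeal,
    Set.image_image (fun a => monomial a (1 : K)) polarize] at hright
  rw [hgen, ← hleft, hright]
end
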